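/- arXiv:2409.00428 — 2 statements merged into one kernel-verified Lean document; each statement's English description precedes it below -/
import Mathlib

section
/- Let 1 ≤ Y ≤ x, let w be a smooth cutoff as specified, let q ≥ 1, and suppose the positive integer n satisfies n ≥ K·q³/x for a suitable absolute constant K (i.e., n ≫ q³/x). Then for every ε > 0 one has both ŵ_q(n) ≪_ε x^{1+ε} and ŵ_q(n) ≪ x^{1/3} q² / n^{2/3}. -/
open scoped BigOperators

/-- `U(X) = (1/2πi) ∫_{(c)} (Γ(s/2)/Γ((1−s)/2))³ X^{−s} ds`, the integral over the
vertical line `Re s = c`, parametrised by `s = c + it` (so `ds = i dt`). -/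
noncomputable def U (c X : ℝ) : ℂ :=
  (1 / (2 * Real.pi)) * ∫ t : ℝ,
    (Complex.Gamma (((c : ℂ) + (t : ℂ) * Complex.I) / 2) /
        Complex.Gamma ((1 - ((c : ℂ) + (t : ℂ) * Complex.I)) / 2)) ^ 3 *
      (X : ℂ) ^ (-((c : ℂ) + (t : ℂ) * Complex.I))

/-- the transform `ŵ_q(n) = ∫₀^∞ w(t) U(Nt) dt` with `N = π³n/q³`. -/
noncomputable def what (c : ℝ) (w : ℝ → ℝ) (q n : ℕ) : ℂ :=
  ∫ t in Set.Ioi (0 : ℝ), (w t : ℂ) * U c (Real.pi ^ 3 * n / q ^ 3 * t)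

section

open Complex MeasureTheory Set Filter Topology

lemma integrableOn_rpow_mul_exp {c k : ℝ} (hc : 0 < c) (hk : 0 < k) :
    IntegrableOn (fun u : ℝ => u ^ (c - 1) * Real.exp (-k * u)) (Ioi 0) := by
  simpa using integrableOn_rpow_mul_exp_neg_mul_rpow (p := 1) (s := c - 1) (b := k)
    (by linarith) one_pos hk

lemma mellinConvergent_exp {z s : ℂ} (hz : 0 < z.re) (hs : 0 < s.re) :
    MellinConvergent (fun u : ℝ => cexp (-z * u)) s := by
  rw [MellinConvergent, mellin_convergent_iff_norm Subset.rfl measurableSet_Ioi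
    (by fun_prop)]
  simpa [Complex.norm_exp] using integrableOn_rpow_mul_exp hs hz

lemma differentiableOn_mellin_exp {s : ℂ} (hs : 0 < s.re) :
    DifferentiableOn ℂ (fun z : ℂ => mellin (fun u : ℝ => cexp (-z * u)) s) {z | 0 < z.re} := by
  intro z hz
  have hz : 0 < z.re := hz
  apply DifferentiableAt.differentiableWithinAt
  have hnb : {w : ℂ | z.re / 2 < w.re} ∈ 𝓝 z :=
    (isOpen_lt continuous_const Complex.continuous_re).mem_nhds (by simp; linarith)
  have h := hasDerivAt_integral_of_dominated_loc_of_deriv_le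
    (μ := volume.restrict (Ioi (0 : ℝ)))
    (F := fun (w : ℂ) (u : ℝ) => (u : ℂ) ^ (s - 1) • cexp (-w * u))
    (F' := fun (w : ℂ) (u : ℝ) => (u : ℂ) ^ (s - 1) • (-u * cexp (-w * u)))
    (bound := fun u => u ^ (s.re + 1 - 1) * Real.exp (-(z.re / 2) * u)) (x₀ := z) hnb
    ?_ ?_ ?_ ?_ ?_ ?_
  · exact h.2.differentiableAt
  · refine Eventually.of_forall fun w => ?_
    exact (((Complex.measurable_ofReal.pow_const (s - 1)).smul
      (by fun_prop : Measurable fun u : ℝ => cexp (-w * u)))).aestronglyMeasurable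
  · exact mellinConvergent_exp hz hs
  · exact (((Complex.measurable_ofReal.pow_const (s - 1)).smul
      (by fun_prop : Measurable fun u : ℝ => -(u : ℂ) * cexp (-z * u)))).aestronglyMeasurable
  · refine (ae_restrict_mem measurableSet_Ioi).mono fun u hu w hw => ?_
    have hu : 0 < u := hu
    have hw : z.re / 2 < w.re := hw
    rw [norm_smul, norm_cpow_eq_rpow_re_of_pos hu, norm_mul, Complex.norm_exp, norm_neg,
      Complex.norm_real, Real.norm_of_nonneg hu.le, ← mul_assoc]
    have : u ^ (s - 1).re * u = u ^ (s.re + 1 - 1) := by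
      nth_rw 2 [← Real.rpow_one u]
      rw [← Real.rpow_add hu]; congr 1; simp
    rw [this]
    gcongr
    simp
    nlinarith
  · exact integrableOn_rpow_mul_exp (by linarith) (by linarith)
  · refine Eventually.of_forall fun u w hw => ?_
    have : HasDerivAt (fun w : ℂ => -w * u) (-u : ℂ) w := by
      simpa using (hasDerivAt_id w).neg.mul_const (u : ℂ)
    simpa [mul_comm, mul_left_comm] using this.cexp.const_mul ((u : ℂ) ^ (s - 1))

lemma mellin_exp {z s : ℂ} (hz : 0 < z.re) (hs : 0 < s.re) :
    mellin (fun u : ℝ => cexp (-z * u)) s = z ^ (-s) * Gamma s := by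
  have hopen : IsOpen {z : ℂ | 0 < z.re} := isOpen_lt continuous_const Complex.continuous_re
  have hconn : IsPreconnected {z : ℂ | 0 < z.re} := (convex_halfSpace_re_gt 0).isPreconnected
  have h1 := (differentiableOn_mellin_exp hs).analyticOnNhd hopen
  have h2 : AnalyticOnNhd ℂ (fun z : ℂ => z ^ (-s) * Gamma s) {z : ℂ | 0 < z.re} := by
    refine DifferentiableOn.analyticOnNhd (fun w hw => ?_) hopen
    have : w ∈ slitPlane := Or.inl hw
    exact ((differentiableAt_id.cpow_const this).mul_const _).differentiableWithinAt
  refine h1.eqOn_of_preconnected_of_frequently_eq h2 hconn (z₀ := 1) (by simp) ?_ hz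
  have hu : Tendsto (fun n : ℕ => (((1 : ℝ) + 1 / (n + 1) : ℝ) : ℂ)) atTop (𝓝[≠] 1) := by
    rw [tendsto_nhdsWithin_iff]
    constructor
    · have := (tendsto_one_div_add_atTop_nhds_zero_nat (𝕜 := ℝ)).const_add 1
      simpa [Function.comp_def] using (Complex.continuous_ofReal.tendsto _).comp this
    · refine Eventually.of_forall fun n => ?_
      have : (0 : ℝ) < 1 / (n + 1) := by positivity
      rw [mem_compl_iff, mem_singleton_iff, Complex.ofReal_eq_one]
      linarith
  refine hu.frequently (Frequently.of_forall fun n => ?_)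
  have hr : (0 : ℝ) < 1 + 1 / (n + 1) := by positivity
  generalize (1 : ℝ) + 1 / (n + 1) = r at hr
  have := integral_cpow_mul_exp_neg_mul_Ioi hs hr
  rw [mellin]
  simp only [smul_eq_mul, neg_mul]
  rw [this, one_div, inv_cpow _ _ (by rw [arg_ofReal_of_nonneg hr.le]; exact Real.pi_pos.ne),
    cpow_neg]

lemma cexp_re_pos (l : ℝ) {θ : ℝ} (h1 : -(Real.pi / 2) < θ) (h2 : θ < Real.pi / 2) :
    0 < (cexp (l + θ * I)).re := by
  rw [Complex.exp_re]
  have := Real.cos_pos_of_mem_Ioo ⟨h1, h2⟩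
  simp only [add_re, ofReal_re, mul_re, I_re, mul_zero, ofReal_im, I_im, mul_one, sub_self,
    add_zero, add_im, mul_im, zero_add]
  positivity

lemma mellin_exp_polar (l : ℝ) {θ : ℝ} {s : ℂ} (h1 : -(Real.pi / 2) < θ) (h2 : θ < Real.pi / 2)
    (hs : 0 < s.re) :
    mellin (fun u : ℝ => cexp (-cexp (l + θ * I) * u)) s =
      cexp (-(l + θ * I) * s) * Gamma s := by
  rw [mellin_exp (cexp_re_pos l h1 h2) hs, cpow_def_of_ne_zero (Complex.exp_ne_zero _),
    Complex.log_exp (by simp; linarith [Real.pi_pos]) (by simp; linarith [Real.pi_pos])]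
  ring_nf

/-- The Mellin transform of `u ↦ exp (-e^(l + iθ) u)` on the line `Re s = c`. -/
noncomputable def gammaRot (l θ c t : ℝ) : ℂ :=
  cexp (-(l + θ * I) * (c + t * I)) * Gamma (c + t * I)

lemma norm_gammaRot (l θ c t : ℝ) :
    ‖gammaRot l θ c t‖ = Real.exp (-l * c + θ * t) * ‖Gamma (c + t * I)‖ := by
  simp [gammaRot, Complex.norm_exp]

lemma continuous_Gamma_line {c : ℝ} (hc : 0 < c) :
    Continuous fun t : ℝ => Gamma (c + t * I) := by
  refine continuous_iff_continuousAt.2 fun t => ?_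
  refine (differentiableAt_Gamma _ fun m h => ?_).continuousAt.comp (by fun_prop)
  have := congrArg Complex.re h
  simp at this
  have : (0 : ℝ) ≤ m := by positivity
  linarith

lemma continuous_gammaRot (l θ : ℝ) {c : ℝ} (hc : 0 < c) : Continuous (gammaRot l θ c) :=
  Continuous.mul (by fun_prop) (continuous_Gamma_line hc)

lemma norm_gammaRot_le (l : ℝ) {θ c : ℝ} (h1 : -(Real.pi / 2) < θ) (h2 : θ < Real.pi / 2)
    (hc : 0 < c) : ∃ K, ∀ t, ‖gammaRot l θ c t‖ ≤ K := by
  refine ⟨∫ u in Ioi (0 : ℝ), ‖(u : ℂ) ^ ((c : ℂ) - 1) • cexp (-cexp (l + θ * I) * u)‖,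
    fun t => ?_⟩
  rw [gammaRot, ← mellin_exp_polar l h1 h2 (by simpa), mellin]
  refine (norm_integral_le_integral_norm _).trans (le_of_eq ?_)
  refine setIntegral_congr_fun measurableSet_Ioi fun u hu => ?_
  have hu : 0 < u := hu
  simp [norm_cpow_eq_rpow_re_of_pos hu]

lemma integrable_gammaRot (l : ℝ) {θ c : ℝ} (h1 : -(Real.pi / 2) < θ) (h2 : θ < Real.pi / 2)
    (hc : 0 < c) : Integrable (gammaRot l θ c) := by
  obtain ⟨d, hd, hd1, hd2⟩ : ∃ d > 0, -(Real.pi / 2) < θ - d ∧ θ + d < Real.pi / 2 := by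
    refine ⟨min (θ + Real.pi / 2) (Real.pi / 2 - θ) / 2, ?_, ?_, ?_⟩
    · have : 0 < min (θ + Real.pi / 2) (Real.pi / 2 - θ) := lt_min (by linarith) (by linarith)
      linarith
    · have := min_le_left (θ + Real.pi / 2) (Real.pi / 2 - θ)
      linarith
    · have := min_le_right (θ + Real.pi / 2) (Real.pi / 2 - θ)
      linarith
  obtain ⟨K₁, hK₁⟩ := norm_gammaRot_le l hd1 (by linarith) hc
  obtain ⟨K₂, hK₂⟩ := norm_gammaRot_le l (by linarith) hd2 hc
  set m := min 1 (d ^ 2 / 2)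
  have hm : 0 < m := by positivity
  refine (integrable_inv_one_add_sq.const_mul ((K₁ + K₂) / m)).mono'
    (continuous_gammaRot l θ hc).aestronglyMeasurable (Eventually.of_forall fun t => ?_)
  have key : Real.exp (d * |t|) * ‖gammaRot l θ c t‖ ≤ K₁ + K₂ := by
    have e1 := hK₁ t
    have e2 := hK₂ t
    have f1 := (norm_nonneg _).trans e1
    have f2 := (norm_nonneg _).trans e2
    rw [norm_gammaRot] at e1 e2 ⊢
    rw [← mul_assoc, ← Real.exp_add]
    rcases abs_cases t with ⟨h, -⟩ | ⟨h, -⟩ <;> rw [h]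
    · ring_nf at e1 e2 ⊢
      linarith
    · ring_nf at e1 e2 ⊢
      linarith
  have hexp : m * (1 + t ^ 2) ≤ Real.exp (d * |t|) := by
    have := Real.quadratic_le_exp_of_nonneg (x := d * |t|) (by positivity)
    rw [mul_pow, sq_abs] at this
    have a1 : m ≤ 1 := min_le_left _ _
    have a2 : m ≤ d ^ 2 / 2 := min_le_right _ _
    have a3 : 0 ≤ d * |t| := by positivity
    nlinarith [sq_nonneg t]
  have h3 : m * (1 + t ^ 2) * ‖gammaRot l θ c t‖ ≤ K₁ + K₂ :=
    (mul_le_mul_of_nonneg_right hexp (norm_nonneg _)).trans key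
  rw [div_mul_eq_mul_div, ← div_eq_mul_inv, div_div, le_div_iff₀ (by positivity)]
  linarith

lemma integral_gammaRot_mul_exp (l : ℝ) {θ c : ℝ} (h1 : -(Real.pi / 2) < θ)
    (h2 : θ < Real.pi / 2) (hc : 0 < c) (y : ℝ) :
    ∫ t : ℝ, gammaRot l θ c t * cexp ((c + t * I) * y) =
      2 * Real.pi * cexp (-cexp (l + θ * I) * Real.exp (-y)) := by
  have hmel : ∀ t : ℝ, mellin (fun u : ℝ => cexp (-cexp (l + θ * I) * u)) (c + t * I) =
      gammaRot l θ c t := fun t => mellin_exp_polar l h1 h2 (by simpa)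
  have h := mellinInv_mellin_eq c (fun u : ℝ => cexp (-cexp (l + θ * I) * u))
    (x := Real.exp (-y)) (Real.exp_pos _) (mellinConvergent_exp (cexp_re_pos l h1 h2) (by simpa))
    ?_ (by fun_prop)
  · simp only [mellinInv, hmel] at h
    rw [← h, Complex.real_smul]
    push_cast
    rw [← mul_assoc, mul_one_div_cancel (by simp), one_mul]
    refine integral_congr_ae (Eventually.of_forall fun t => ?_)
    simp only [smul_eq_mul]
    rw [cpow_def_of_ne_zero (Complex.exp_ne_zero _), ← Complex.ofReal_neg, ← Complex.ofReal_exp,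
      ← Complex.ofReal_log (Real.exp_pos _).le, Real.log_exp, mul_comm]
    push_cast
    ring_nf
  · simpa only [VerticalIntegrable, hmel] using integrable_gammaRot l h1 h2 hc

lemma integrable_exp_log {z : ℂ} {c t : ℝ} (hz : 0 < z.re) (hc : 0 < c) :
    Integrable (fun a : ℝ => cexp (-z * Real.exp a) * cexp ((c + t * I) * a)) ∧
      ∫ a : ℝ, cexp (-z * Real.exp a) * cexp ((c + t * I) * a) =
        mellin (fun u : ℝ => cexp (-z * u)) (c + t * I) := by
  have himg : Set.image Real.exp univ = Ioi 0 := by rw [image_univ, Real.range_exp]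
  have hd : ∀ x ∈ univ, HasDerivWithinAt Real.exp (Real.exp x) univ x :=
    fun x _ => (Real.hasDerivAt_exp x).hasDerivWithinAt
  have heq : ∀ a : ℝ, |Real.exp a| • ((Real.exp a : ℂ) ^ ((c + t * I : ℂ) - 1) •
      cexp (-z * Real.exp a)) = cexp (-z * Real.exp a) * cexp ((c + t * I) * a) := by
    intro a
    rw [abs_of_pos (Real.exp_pos a), cpow_def_of_ne_zero (by simp), ← Complex.ofReal_log
      (Real.exp_pos a).le, Real.log_exp, Complex.real_smul, smul_eq_mul, ← mul_assoc,
      Complex.ofReal_exp, ← Complex.exp_add, mul_comm]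
    ring_nf
  constructor
  · have := mellinConvergent_exp (s := c + t * I) hz (by simpa)
    rw [MellinConvergent, ← himg, integrableOn_image_iff_integrableOn_abs_deriv_smul
      MeasurableSet.univ hd Real.exp_injective.injOn, integrableOn_univ] at this
    simpa only [heq] using this
  · rw [mellin, ← himg, integral_image_eq_integral_abs_deriv_smul MeasurableSet.univ hd
      Real.exp_injective.injOn, setIntegral_univ]
    simp only [heq]

lemma integral_gammaRot_pow_three (l : ℝ) {θ c : ℝ} (h1 : -(Real.pi / 2) < θ)
    (h2 : θ < Real.pi / 2) (hc : 0 < c) :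
    ∫ t : ℝ, gammaRot l θ c t ^ 3 = 2 * Real.pi * ∫ p : ℝ × ℝ,
      cexp (-cexp (l + θ * I) *
        (Real.exp p.1 + Real.exp p.2 + Real.exp (-p.1 - p.2) : ℝ)) := by
  set z := cexp (l + θ * I) with hz
  have hz0 : 0 < z.re := cexp_re_pos l h1 h2
  set h : ℝ → ℝ → ℂ := fun t a => cexp (-z * Real.exp a) * cexp ((c + t * I) * a) with hh
  have hcube : ∀ t, gammaRot l θ c t ^ 3 =
      ∫ p : ℝ × ℝ, gammaRot l θ c t * (h t p.1 * h t p.2) := by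
    intro t
    have : ∫ a, h t a = gammaRot l θ c t := by
      rw [hh]
      simp only
      rw [(integrable_exp_log hz0 hc).2, mellin_exp_polar l h1 h2 (by simpa), gammaRot]
    rw [integral_const_mul, Measure.volume_eq_prod, integral_prod_mul, this]
    ring
  simp_rw [hcube]
  rw [integral_integral_swap, ← integral_const_mul]
  · congr 1 with p
    have : ∀ t : ℝ, gammaRot l θ c t * (h t p.1 * h t p.2) =
        cexp (-z * Real.exp p.1) * cexp (-z * Real.exp p.2) *
          (gammaRot l θ c t * cexp ((c + t * I) * (p.1 + p.2 : ℝ))) := by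
      intro t
      simp only [hh, ofReal_add, mul_add, Complex.exp_add]
      ring
    simp_rw [this]
    rw [integral_const_mul, integral_gammaRot_mul_exp l h1 h2 hc, ← hz]
    simp only [ofReal_add, mul_add, Complex.exp_add, neg_add']
    ring
  · have hi := (integrable_gammaRot l h1 h2 hc).norm.mul_prod
      (((integrable_exp_log (t := 0) hz0 hc).1.norm).mul_prod
        ((integrable_exp_log (t := 0) hz0 hc).1.norm))
    refine hi.mono' ?_ (Eventually.of_forall fun q => ?_)
    · have := continuous_gammaRot l θ hc
      apply Continuous.aestronglyMeasurable
      simp only [hh, Function.uncurry_def]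
      fun_prop
    · simp [hh, Function.uncurry_def, Complex.norm_exp]

lemma abs_exp_sub_one_le_mul {x K : ℝ} (h : x ≤ K) (hK : 0 ≤ K) :
    |Real.exp x - 1| ≤ |x| * Real.exp K := by
  have h1 := Real.add_one_le_exp x
  have h2 := Real.add_one_le_exp (-x)
  have h3 := Real.exp_pos x
  have h4 : Real.exp (-x) * Real.exp x = 1 := by rw [← Real.exp_add]; simp
  have h5 : 1 ≤ Real.exp K := Real.one_le_exp hK
  have h6 : Real.exp x ≤ Real.exp K := Real.exp_le_exp.2 h
  rcases le_total 0 x with hx | hx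
  · rw [abs_of_nonneg (by linarith), abs_of_nonneg hx]
    nlinarith
  · rw [abs_of_nonpos (by linarith [Real.exp_le_one_iff.2 hx]), abs_of_nonpos hx]
    nlinarith

lemma abs_mul_exp_sub_le {x K : ℝ} (h : x ≤ K) (hK : 0 ≤ K) :
    |x * Real.exp x - (Real.exp x - 1)| ≤ x ^ 2 * Real.exp K := by
  have h1 := Real.add_one_le_exp x
  have h2 := Real.add_one_le_exp (-x)
  have h3 := Real.exp_pos x
  have h4 : Real.exp (-x) * Real.exp x = 1 := by rw [← Real.exp_add]; simp
  have h5 : 1 ≤ Real.exp K := Real.one_le_exp hK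
  have h6 : Real.exp x ≤ Real.exp K := Real.exp_le_exp.2 h
  have h7 : 0 ≤ x * Real.exp x - (Real.exp x - 1) := by nlinarith
  rw [abs_of_nonneg h7]
  rcases le_total 0 x with hx | hx
  · have : x ^ 2 * Real.exp x ≤ x ^ 2 * Real.exp K := by gcongr
    nlinarith
  · have : x ^ 2 * 1 ≤ x ^ 2 * Real.exp K := by gcongr
    nlinarith

lemma mul_exp_half_le {y : ℝ} (hy : 0 ≤ y) : y * Real.exp (y / 2) ≤ Real.exp y - 1 := by
  have h := Real.self_le_sinh_iff.2 (by positivity : 0 ≤ y / 2)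
  rw [Real.sinh_eq] at h
  have h1 : Real.exp (y / 2) * Real.exp (y / 2) = Real.exp y := by rw [← Real.exp_add]; ring_nf
  have h2 : Real.exp (-(y / 2)) * Real.exp (y / 2) = 1 := by rw [← Real.exp_add]; simp
  nlinarith [Real.exp_pos (y / 2)]

lemma mul_exp_sub_one_nonneg {a r : ℝ} (hr : 0 ≤ r) : 0 ≤ a * (Real.exp (a * r) - 1) := by
  have h1 := Real.add_one_le_exp (a * r)
  rcases le_total 0 a with h | h
  · exact mul_nonneg h (by nlinarith)
  · exact mul_nonneg_of_nonpos_of_nonpos h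
      (by linarith [Real.exp_le_one_iff.2 (mul_nonpos_of_nonpos_of_nonneg h hr)])

/-- The slopes of `e^x + e^y + e^(-x-y)` along a ray: three numbers of sum zero and maximum `M`. -/
structure RaySlopes (α β γ M : ℝ) : Prop where
  sum : α + β + γ = 0
  hα : α ≤ M
  hβ : β ≤ M
  hγ : γ ≤ M
  hα' : |α| ≤ 2
  hβ' : |β| ≤ 2
  hγ' : |γ| ≤ 2
  hM : 1 / 3 ≤ M
  eq : M = α ∨ M = β ∨ M = γ

namespace RaySlopes

variable {α β γ M r : ℝ}

lemma exp_le_sum (h : RaySlopes α β γ M) :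
    Real.exp (M * r) ≤ Real.exp (α * r) + Real.exp (β * r) + Real.exp (γ * r) := by
  have := Real.exp_pos (α * r)
  have := Real.exp_pos (β * r)
  have := Real.exp_pos (γ * r)
  rcases h.eq with e | e | e <;> rw [e] <;> linarith

lemma sum_le_exp (h : RaySlopes α β γ M) (hr : 0 ≤ r) :
    Real.exp (α * r) + Real.exp (β * r) + Real.exp (γ * r) ≤ 3 * Real.exp (M * r) := by
  have := Real.exp_le_exp.2 (mul_le_mul_of_nonneg_right h.hα hr)
  have := Real.exp_le_exp.2 (mul_le_mul_of_nonneg_right h.hβ hr)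
  have := Real.exp_le_exp.2 (mul_le_mul_of_nonneg_right h.hγ hr)
  linarith

lemma deriv_ge (h : RaySlopes α β γ M) (hr : 0 ≤ r) : M ^ 2 * r * Real.exp (M * r / 2) ≤
    α * Real.exp (α * r) + β * Real.exp (β * r) + γ * Real.exp (γ * r) := by
  have h1 := mul_exp_sub_one_nonneg (a := α) hr
  have h2 := mul_exp_sub_one_nonneg (a := β) hr
  have h3 := mul_exp_sub_one_nonneg (a := γ) hr
  have hM : 0 < M := by linarith [h.hM]
  have h4 := mul_le_mul_of_nonneg_left (mul_exp_half_le (y := M * r) (by positivity)) hM.le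
  have h5 := h.sum
  have : M * (Real.exp (M * r) - 1) ≤ α * (Real.exp (α * r) - 1) + β * (Real.exp (β * r) - 1)
      + γ * (Real.exp (γ * r) - 1) := by
    rcases h.eq with e | e | e <;> rw [e] <;> linarith
  nlinarith

lemma abs_deriv_le (h : RaySlopes α β γ M) (hr : 0 ≤ r) :
    |α * Real.exp (α * r) + β * Real.exp (β * r) + γ * Real.exp (γ * r)| ≤
      6 * Real.exp (M * r) := by
  have key : ∀ a, a ≤ M → |a| ≤ 2 → |a * Real.exp (a * r)| ≤ 2 * Real.exp (M * r) := by
    intro a h1 h2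
    rw [abs_mul, abs_of_pos (Real.exp_pos _)]
    gcongr
  have h1 := key α h.hα h.hα'
  have h2 := key β h.hβ h.hβ'
  have h3 := key γ h.hγ h.hγ'
  refine (abs_add_three _ _ _).trans ?_
  linarith

lemma abs_deriv_le' (h : RaySlopes α β γ M) (hr : 0 ≤ r) :
    |α * Real.exp (α * r) + β * Real.exp (β * r) + γ * Real.exp (γ * r)| ≤
      12 * r * Real.exp (M * r) := by
  have hM : 0 < M := by linarith [h.hM]
  have key : ∀ a, a ≤ M → |a| ≤ 2 → |a * (Real.exp (a * r) - 1)| ≤ 4 * r * Real.exp (M * r) := by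
    intro a h1 h2
    have := abs_exp_sub_one_le_mul (mul_le_mul_of_nonneg_right h1 hr) (by positivity)
    rw [abs_mul] at this ⊢
    rw [abs_of_nonneg hr] at this
    calc |a| * |Real.exp (a * r) - 1| ≤ |a| * (|a| * r * Real.exp (M * r)) := by gcongr
      _ ≤ 2 * (2 * r * Real.exp (M * r)) := by gcongr
      _ = _ := by ring
  have h1 := key α h.hα h.hα'
  have h2 := key β h.hβ h.hβ'
  have h3 := key γ h.hγ h.hγ'
  have h4 := h.sum
  have : α * Real.exp (α * r) + β * Real.exp (β * r) + γ * Real.exp (γ * r) =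
      α * (Real.exp (α * r) - 1) + β * (Real.exp (β * r) - 1) + γ * (Real.exp (γ * r) - 1) := by
    linear_combination h4
  rw [this]
  refine (abs_add_three _ _ _).trans ?_
  linarith

lemma abs_deriv_sub_le (h : RaySlopes α β γ M) (hr : 0 ≤ r) :
    |α * Real.exp (α * r) + β * Real.exp (β * r) + γ * Real.exp (γ * r) -
      r * (α ^ 2 * Real.exp (α * r) + β ^ 2 * Real.exp (β * r) + γ ^ 2 * Real.exp (γ * r))| ≤
      24 * r ^ 2 * Real.exp (M * r) := by
  have hM : 0 < M := by linarith [h.hM]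
  have key : ∀ a, a ≤ M → |a| ≤ 2 →
      |a * (a * r * Real.exp (a * r) - (Real.exp (a * r) - 1))| ≤ 8 * r ^ 2 * Real.exp (M * r) := by
    intro a h1 h2
    have := abs_mul_exp_sub_le (mul_le_mul_of_nonneg_right h1 hr) (by positivity)
    rw [abs_mul]
    calc |a| * |a * r * Real.exp (a * r) - (Real.exp (a * r) - 1)|
        ≤ |a| * ((a * r) ^ 2 * Real.exp (M * r)) := by gcongr
      _ = |a| * |a| ^ 2 * r ^ 2 * Real.exp (M * r) := by rw [sq_abs]; ring
      _ ≤ 2 * 2 ^ 2 * r ^ 2 * Real.exp (M * r) := by gcongr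
      _ = _ := by ring
  have h1 := key α h.hα h.hα'
  have h2 := key β h.hβ h.hβ'
  have h3 := key γ h.hγ h.hγ'
  have h4 := h.sum
  rw [abs_sub_comm]
  have : r * (α ^ 2 * Real.exp (α * r) + β ^ 2 * Real.exp (β * r) + γ ^ 2 * Real.exp (γ * r)) -
      (α * Real.exp (α * r) + β * Real.exp (β * r) + γ * Real.exp (γ * r)) =
      α * (α * r * Real.exp (α * r) - (Real.exp (α * r) - 1)) +
      β * (β * r * Real.exp (β * r) - (Real.exp (β * r) - 1)) +
      γ * (γ * r * Real.exp (γ * r) - (Real.exp (γ * r) - 1)) := by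
    linear_combination (-1) * h4
  rw [this]
  refine (abs_add_three _ _ _).trans ?_
  linarith

end RaySlopes

namespace RaySlopes

variable {α β γ M r : ℝ}

lemma hasDerivAt_sum (α β γ a b c r : ℝ) :
    HasDerivAt (fun r => a * Real.exp (α * r) + b * Real.exp (β * r) + c * Real.exp (γ * r))
      (a * α * Real.exp (α * r) + b * β * Real.exp (β * r) + c * γ * Real.exp (γ * r)) r := by
  have key : ∀ a α : ℝ, HasDerivAt (fun r => a * Real.exp (α * r))
      (a * α * Real.exp (α * r)) r := by
    intro a α
    have := (((hasDerivAt_id r).const_mul α).exp).const_mul a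
    rwa [mul_one, mul_comm _ α, ← mul_assoc] at this
  exact ((key a α).add (key b β)).add (key c γ)

/-- The integral of `(r / g) e^(-z g)` along a ray, for `g` a sum of three exponentials. -/
lemma norm_integral_le (h : RaySlopes α β γ M) {z : ℂ} (hz : 0 < z.re) :
    ‖∫ r in Ioi (0 : ℝ), ((r / (Real.exp (α * r) + Real.exp (β * r) + Real.exp (γ * r)) : ℝ) : ℂ) *
      cexp (-z * (Real.exp (α * r) + Real.exp (β * r) + Real.exp (γ * r) : ℝ))‖ ≤
      35001 / ‖z‖ := by
  have hM : 0 < M := by linarith [h.hM]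
  have hz0 : z ≠ 0 := by rintro rfl; simp at hz
  have hzn : 0 < ‖z‖ := norm_pos_iff.2 hz0
  set g : ℝ → ℝ := fun r => Real.exp (α * r) + Real.exp (β * r) + Real.exp (γ * r) with hg
  set g1 : ℝ → ℝ := fun r => α * Real.exp (α * r) + β * Real.exp (β * r) + γ * Real.exp (γ * r)
    with hg1
  set g2 : ℝ → ℝ := fun r => α ^ 2 * Real.exp (α * r) + β ^ 2 * Real.exp (β * r) +
    γ ^ 2 * Real.exp (γ * r) with hg2
  have dg : ∀ r, HasDerivAt g (g1 r) r := fun r => by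
    simpa [hg, hg1] using hasDerivAt_sum α β γ 1 1 1 r
  have dg1 : ∀ r, HasDerivAt g1 (g2 r) r := fun r => by
    simpa [hg1, hg2, sq] using hasDerivAt_sum α β γ α β γ r
  have gpos : ∀ r, 0 < g r := fun r => by positivity
  have g1pos : ∀ r, 0 < r → 0 < g1 r := fun r hr =>
    lt_of_lt_of_le (by positivity) (h.deriv_ge hr.le)
  have cg : Continuous g := by fun_prop
  have cg1 : Continuous g1 := by fun_prop
  have cg2 : Continuous g2 := by fun_prop
  have dcE : ∀ r, HasDerivAt (fun r : ℝ => cexp (-z * (g r : ℝ)))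
      (-z * g1 r * cexp (-z * (g r : ℝ))) r := fun r => by
    convert (((dg r).ofReal_comp).const_mul (-z)).cexp using 1
    ring
  have nE : ∀ r, ‖cexp (-z * (g r : ℝ))‖ ≤ 1 := fun r => by
    rw [Complex.norm_exp]
    simp only [neg_mul, neg_re, re_mul_ofReal, Real.exp_le_one_iff]
    have := gpos r
    have : 0 < z.re * g r := by positivity
    linarith
  set q : ℝ → ℝ := fun r => r / (g r * g1 r) with hq
  set q' : ℝ → ℝ := fun r => (1 * (g r * g1 r) - r * (g1 r * g1 r + g r * g2 r)) / (g r * g1 r) ^ 2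
    with hq'
  have dq : ∀ r, 0 < r → HasDerivAt q (q' r) r := fun r hr =>
    (hasDerivAt_id r).div ((dg r).mul (dg1 r)) (mul_pos (gpos r) (g1pos r hr)).ne'
  have bq : ∀ r, 0 < r → |q r| ≤ 9 * Real.exp (-M * r) := fun r hr => by
    have h1 := h.exp_le_sum (r := r)
    have h2 := h.deriv_ge hr.le
    have h3 : M ^ 2 * r * 1 ≤ M ^ 2 * r * Real.exp (M * r / 2) := by
      gcongr; exact Real.one_le_exp (by positivity)
    have h4 : 1 / 9 ≤ M ^ 2 := by nlinarith [h.hM]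
    have h5 : 1 / 9 * r ≤ g1 r := by
      refine le_trans ?_ h2; nlinarith
    have h6 := Real.exp_pos (M * r)
    rw [abs_of_nonneg (div_nonneg hr.le (mul_pos (gpos r) (g1pos r hr)).le), neg_mul,
      Real.exp_neg, div_le_iff₀ (mul_pos (gpos r) (g1pos r hr))]
    calc r = 9 * (Real.exp (M * r))⁻¹ * (Real.exp (M * r) * (1 / 9 * r)) := by field_simp
      _ ≤ _ := by gcongr
  have bq' : ∀ r, 0 < r → |q' r| ≤ 11664 * Real.exp (-M * r) := fun r hr => by
    have h1 := h.exp_le_sum (r := r)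
    have h2 := h.deriv_ge hr.le
    have h1' := h.sum_le_exp hr.le
    have h3 := h.abs_deriv_sub_le hr.le
    have h4 := h.abs_deriv_le hr.le
    have h5 := h.abs_deriv_le' hr.le
    have h6 := Real.exp_pos (M * r)
    have num : |1 * (g r * g1 r) - r * (g1 r * g1 r + g r * g2 r)| ≤
        144 * r ^ 2 * Real.exp (M * r) ^ 2 := by
      have : 1 * (g r * g1 r) - r * (g1 r * g1 r + g r * g2 r) =
          g r * (g1 r - r * g2 r) - r * (g1 r * g1 r) := by ring
      rw [this]
      refine (abs_sub _ _).trans ?_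
      rw [abs_mul, abs_mul, abs_mul, abs_of_pos (gpos r), abs_of_pos hr]
      calc g r * |g1 r - r * g2 r| + r * (|g1 r| * |g1 r|) ≤
          (3 * Real.exp (M * r)) * (24 * r ^ 2 * Real.exp (M * r)) +
          r * ((6 * Real.exp (M * r)) * (12 * r * Real.exp (M * r))) := by gcongr
        _ = _ := by ring
    have h7 : 1 / 81 ≤ M ^ 4 := by
      have := pow_le_pow_left₀ (by norm_num) h.hM 4
      norm_num at this ⊢; linarith
    have h8 : Real.exp (M * r / 2) ^ 2 = Real.exp (M * r) := by
      rw [← Real.exp_nat_mul]; congr 1; push_cast; ring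
    have den : 1 / 81 * r ^ 2 * Real.exp (M * r) ^ 3 ≤ (g r * g1 r) ^ 2 := by
      calc 1 / 81 * r ^ 2 * Real.exp (M * r) ^ 3 ≤ M ^ 4 * r ^ 2 * Real.exp (M * r) ^ 3 := by
            gcongr
        _ = (Real.exp (M * r) * (M ^ 2 * r * Real.exp (M * r / 2))) ^ 2 := by
            rw [mul_pow, mul_pow, h8]; ring
        _ ≤ _ := by gcongr
    rw [hq']
    simp only
    rw [abs_div, abs_of_nonneg (sq_nonneg (g r * g1 r)), neg_mul, Real.exp_neg]
    calc _ ≤ (144 * r ^ 2 * Real.exp (M * r) ^ 2) / (1 / 81 * r ^ 2 * Real.exp (M * r) ^ 3) := by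
          gcongr
      _ = _ := by field_simp; norm_num
  have cq' : ContinuousOn q' (Ioi 0) := by
    refine ContinuousOn.div (by fun_prop) (by fun_prop) fun r hr => ?_
    exact pow_ne_zero _ (mul_pos (gpos r) (g1pos r hr)).ne'
  have iexp : IntegrableOn (fun r => Real.exp (-M * r)) (Ioi 0) := exp_neg_integrableOn_Ioi 0 hM
  have iu' : IntegrableOn (fun r => (q' r : ℂ) * cexp (-z * (g r : ℝ))) (Ioi 0) := by
    refine (iexp.const_mul 11664).mono' ?_ ?_
    · refine ContinuousOn.aestronglyMeasurable ?_ measurableSet_Ioi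
      exact (continuous_ofReal.comp_continuousOn cq').mul (by fun_prop)
    · filter_upwards [ae_restrict_mem measurableSet_Ioi] with r hr
      rw [norm_mul, norm_real, Real.norm_eq_abs]
      exact (mul_le_of_le_one_right (abs_nonneg _) (nE r)).trans (bq' r hr)
  have iv : IntegrableOn (fun r => ((r / g r : ℝ) : ℂ) * cexp (-z * (g r : ℝ))) (Ioi 0) := by
    have : IntegrableOn (fun r => r * Real.exp (-M * r)) (Ioi 0) := by
      simpa using integrableOn_rpow_mul_exp_neg_mul_rpow (s := 1) (p := 1) (by norm_num)
        one_pos hM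
    refine this.mono' ?_ ?_
    · refine Continuous.aestronglyMeasurable ?_
      refine Continuous.mul (continuous_ofReal.comp ?_) (by fun_prop)
      exact continuous_id.div cg fun r => (gpos r).ne'
    · filter_upwards [ae_restrict_mem measurableSet_Ioi] with r hr
      have hr : 0 < r := hr
      rw [norm_mul, norm_real, Real.norm_eq_abs, abs_of_nonneg (div_nonneg hr.le (gpos r).le)]
      refine (mul_le_of_le_one_right (div_nonneg hr.le (gpos r).le) (nE r)).trans ?_
      rw [neg_mul, Real.exp_neg, ← div_eq_mul_inv]
      have := h.exp_le_sum (r := r)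
      gcongr
  have hu0 : ∃ a : ℝ, Tendsto q (𝓝[>] 0) (𝓝 a) := by
    have t1 : Tendsto (fun r => r⁻¹ * g1 r) (𝓝[>] 0) (𝓝 (g2 0)) := by
      have := (hasDerivAt_iff_tendsto_slope_zero.1 (dg1 0)).mono_left
        (nhdsWithin_mono 0 (s := Ioi 0) (fun r (hr : 0 < r) => hr.ne'))
      have e : g1 0 = 0 := by simp [hg1, h.sum]
      simpa [e] using this
    have t2 : Tendsto g (𝓝[>] 0) (𝓝 (g 0)) := cg.continuousAt.tendsto.mono_left nhdsWithin_le_nhds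
    have hM2 : g2 0 ≠ 0 := by
      have : 0 < M ^ 2 := by positivity
      refine ne_of_gt ?_
      simp only [hg2, mul_zero, Real.exp_zero, mul_one]
      rcases h.eq with e | e | e <;> rw [e] at this <;> positivity
    refine ⟨_, ((t2.mul t1).inv₀ (mul_ne_zero (gpos 0).ne' hM2)).congr' ?_⟩
    filter_upwards [self_mem_nhdsWithin] with r hr
    have hr : 0 < r := hr
    have := gpos r
    have := g1pos r hr
    simp only [hq]
    field_simp
  obtain ⟨a, ha⟩ := hu0
  have hain : |a| ≤ 9 := by
    refine le_of_tendsto ha.abs ?_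
    filter_upwards [self_mem_nhdsWithin] with r hr
    refine (bq r hr).trans ?_
    have hr : 0 < r := hr
    have : Real.exp (-M * r) ≤ 1 := Real.exp_le_one_iff.2 (by nlinarith)
    linarith
  have parts := integral_Ioi_deriv_mul_eq_sub (a := 0) (a' := (a : ℂ) * cexp (-z * (g 0 : ℝ)))
    (b' := 0) (u := fun r => (q r : ℂ)) (u' := fun r => (q' r : ℂ))
    (v := fun r : ℝ => cexp (-z * (g r : ℝ))) (v' := fun r => -z * g1 r * cexp (-z * (g r : ℝ)))
    (fun r hr => (dq r hr).ofReal_comp) (fun r _ => dcE r) ?_ ?_ ?_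
  · have e2 : ∀ r ∈ Ioi (0 : ℝ), (q r : ℂ) * (-z * g1 r * cexp (-z * (g r : ℝ))) =
        -z * (((r / g r : ℝ) : ℂ) * cexp (-z * (g r : ℝ))) := fun r hr => by
      have h1 : (g1 r : ℂ) ≠ 0 := ofReal_ne_zero.2 (g1pos r hr).ne'
      have h2 : (g r : ℂ) ≠ 0 := ofReal_ne_zero.2 (gpos r).ne'
      simp only [hq]
      push_cast
      field_simp
    have e3 : ∫ r in Ioi (0 : ℝ), ((q' r : ℂ) * cexp (-z * (g r : ℝ)) +
        (q r : ℂ) * (-z * g1 r * cexp (-z * (g r : ℝ)))) =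
        (∫ r in Ioi (0 : ℝ), (q' r : ℂ) * cexp (-z * (g r : ℝ))) +
        -z * ∫ r in Ioi (0 : ℝ), ((r / g r : ℝ) : ℂ) * cexp (-z * (g r : ℝ)) := by
      rw [← integral_const_mul, ← integral_add iu' (iv.const_mul (-z))]
      refine setIntegral_congr_fun measurableSet_Ioi fun r hr => ?_
      rw [e2 r hr]
    rw [e3] at parts
    have n1 : ‖∫ r in Ioi (0 : ℝ), (q' r : ℂ) * cexp (-z * (g r : ℝ))‖ ≤ 34992 := by
      refine (norm_integral_le_of_norm_le (iexp.const_mul 11664) ?_).trans ?_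
      · filter_upwards [ae_restrict_mem measurableSet_Ioi] with r hr
        rw [norm_mul, norm_real, Real.norm_eq_abs]
        exact (mul_le_of_le_one_right (abs_nonneg _) (nE r)).trans (bq' r hr)
      · rw [integral_const_mul, integral_exp_mul_Ioi (by linarith)]
        simp only [mul_zero, Real.exp_zero, neg_div_neg_eq]
        rw [mul_one_div, div_le_iff₀ hM]
        linarith [h.hM]
    have n2 : ‖(a : ℂ) * cexp (-z * (g 0 : ℝ))‖ ≤ 9 := by
      rw [norm_mul, norm_real, Real.norm_eq_abs]
      exact (mul_le_of_le_one_right (abs_nonneg _) (nE 0)).trans hain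
    rw [le_div_iff₀ hzn, mul_comm, ← norm_mul]
    have : z * ∫ r in Ioi (0 : ℝ), ((r / g r : ℝ) : ℂ) * cexp (-z * (g r : ℝ)) =
        (∫ r in Ioi (0 : ℝ), (q' r : ℂ) * cexp (-z * (g r : ℝ))) +
        (a : ℂ) * cexp (-z * (g 0 : ℝ)) := by linear_combination (-1) * parts
    rw [this]
    refine (norm_add_le _ _).trans ?_
    linarith
  · refine iu'.add ((iv.const_mul (-z)).congr ?_)
    filter_upwards [ae_restrict_mem measurableSet_Ioi] with r hr
    have h1 : (g1 r : ℂ) ≠ 0 := ofReal_ne_zero.2 (g1pos r hr).ne'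
    have h2 : (g r : ℂ) ≠ 0 := ofReal_ne_zero.2 (gpos r).ne'
    simp only [hq, Pi.mul_apply]
    push_cast
    field_simp
  · refine ((continuous_ofReal.tendsto a).comp ha).mul ?_
    have : Continuous fun r : ℝ => cexp (-z * (g r : ℝ)) := by fun_prop
    exact (this.tendsto 0).mono_left nhdsWithin_le_nhds
  · refine squeeze_zero_norm' (a := fun r => 9 * Real.exp (-M * r)) ?_ ?_
    · filter_upwards [eventually_gt_atTop 0] with r hr
      simp only [Pi.mul_apply]
      rw [norm_mul, norm_real, Real.norm_eq_abs]
      exact (mul_le_of_le_one_right (abs_nonneg _) (nE r)).trans (bq r hr)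
    · have : Tendsto (fun r => -M * r) atTop atBot :=
        tendsto_id.const_mul_atTop_of_neg (by linarith)
      simpa using (Real.tendsto_exp_atBot.comp this).const_mul 9

end RaySlopes

lemma exists_raySlopes_polar (θ : ℝ) :
    ∃ M, RaySlopes (Real.cos θ) (Real.sin θ) (-Real.cos θ - Real.sin θ) M := by
  have h0 := Real.sin_sq_add_cos_sq θ
  have h1 := Real.abs_cos_le_one θ
  have h2 := Real.abs_sin_le_one θ
  refine ⟨max (Real.cos θ) (max (Real.sin θ) (-Real.cos θ - Real.sin θ)), by ring, le_max_left _ _,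
    le_max_of_le_right (le_max_left _ _), le_max_of_le_right (le_max_right _ _), by linarith,
    by linarith, ?_, ?_, ?_⟩
  · rw [abs_le] at *
    constructor <;> linarith
  · by_contra! h
    obtain ⟨h3, h⟩ := max_lt_iff.1 h
    obtain ⟨h4, h5⟩ := max_lt_iff.1 h
    nlinarith
  · rcases max_choice (Real.cos θ) (max (Real.sin θ) (-Real.cos θ - Real.sin θ)) with h | h
    · exact Or.inl h
    · rw [h]
      exact Or.inr (max_choice _ _)

/-- The phase `e^x + e^y + e^(-x-y)`. -/
noncomputable def tripleExp (p : ℝ × ℝ) : ℝ :=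
  Real.exp p.1 + Real.exp p.2 + Real.exp (-p.1 - p.2)

lemma continuous_tripleExp : Continuous tripleExp := by
  unfold tripleExp
  fun_prop

lemma three_le_tripleExp (p : ℝ × ℝ) : 3 ≤ tripleExp p := by
  have h1 := Real.add_one_le_exp p.1
  have h2 := Real.add_one_le_exp p.2
  have h3 := Real.add_one_le_exp (-p.1 - p.2)
  rw [tripleExp]
  linarith

lemma abs_add_abs_le_tripleExp (p : ℝ × ℝ) : |p.1| + |p.2| ≤ 2 * tripleExp p := by
  have key : ∀ x : ℝ, x + |x| ≤ 2 * Real.exp x := fun x => by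
    have h1 := Real.add_one_le_exp x
    have h2 := Real.exp_pos x
    rcases abs_cases x with ⟨h, -⟩ | ⟨h, -⟩ <;> linarith
  have h1 := key p.1
  have h2 := key p.2
  have h3 := key (-p.1 - p.2)
  have := abs_nonneg (-p.1 - p.2)
  rw [tripleExp]
  linarith

lemma integrable_exp_neg_tripleExp {k : ℝ} (hk : 0 < k) :
    Integrable fun p : ℝ × ℝ => Real.exp (-k * tripleExp p) := by
  set m := min 1 (k ^ 2 / 8) with hm
  have hm0 : 0 < m := by positivity
  have key : ∀ x : ℝ, m * (1 + x ^ 2) ≤ Real.exp (k / 2 * |x|) := fun x => by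
    have := Real.quadratic_le_exp_of_nonneg (x := k / 2 * |x|) (by positivity)
    rw [mul_pow, sq_abs] at this
    have a1 : m ≤ 1 := min_le_left _ _
    have a2 : m ≤ k ^ 2 / 8 := min_le_right _ _
    have a3 : 0 ≤ k / 2 * |x| := by positivity
    nlinarith [sq_nonneg x]
  refine ((integrable_inv_one_add_sq.mul_prod integrable_inv_one_add_sq).const_mul
    ((m ^ 2)⁻¹)).mono' ?_ (Eventually.of_forall fun p => ?_)
  · have := continuous_tripleExp
    exact (by fun_prop : Continuous _).aestronglyMeasurable
  · rw [Real.norm_eq_abs, abs_of_pos (Real.exp_pos _), neg_mul, Real.exp_neg, ← mul_inv, ← mul_inv]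
    refine inv_anti₀ (by positivity) ?_
    calc m ^ 2 * ((1 + p.1 ^ 2) * (1 + p.2 ^ 2)) = (m * (1 + p.1 ^ 2)) * (m * (1 + p.2 ^ 2)) := by
          ring
      _ ≤ Real.exp (k / 2 * |p.1|) * Real.exp (k / 2 * |p.2|) :=
          mul_le_mul (key _) (key _) (by positivity) (by positivity)
      _ = Real.exp (k / 2 * (|p.1| + |p.2|)) := by rw [← Real.exp_add]; ring_nf
      _ ≤ _ := by
          have := abs_add_abs_le_tripleExp p
          exact Real.exp_le_exp.2 (by nlinarith)

lemma norm_integral_inv_tripleExp_mul_exp_le {z : ℂ} (hz : 0 < z.re) :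
    ‖∫ p : ℝ × ℝ, ((tripleExp p)⁻¹ : ℝ) * cexp (-z * tripleExp p)‖ ≤
      2 * Real.pi * (35001 / ‖z‖) := by
  rw [← integral_comp_polarCoord_symm, polarCoord_target, Measure.volume_eq_prod,
    ← Measure.prod_restrict]
  by_cases hint : Integrable (fun p : ℝ × ℝ =>
      p.1 • ((((tripleExp (polarCoord.symm p))⁻¹ : ℝ) : ℂ) *
      cexp (-z * tripleExp (polarCoord.symm p))))
      ((volume.restrict (Ioi 0)).prod (volume.restrict (Ioo (-Real.pi) Real.pi)))
  swap
  · rw [integral_undef hint, norm_zero]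
    positivity
  rw [integral_prod_symm _ hint]
  refine (norm_setIntegral_le_of_norm_le_const (C := 35001 / ‖z‖) (by simp) fun θ _ => ?_).trans ?_
  · obtain ⟨M, hM⟩ := exists_raySlopes_polar θ
    refine le_of_eq_of_le (congrArg norm (integral_congr_ae (Eventually.of_forall fun r => ?_)))
      (hM.norm_integral_le hz)
    have : tripleExp (polarCoord.symm (r, θ)) = Real.exp (Real.cos θ * r) +
        Real.exp (Real.sin θ * r) + Real.exp ((-Real.cos θ - Real.sin θ) * r) := by
      rw [polarCoord_symm_apply, tripleExp]
      ring_nf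
    simp only
    rw [this, Complex.real_smul, ← mul_assoc, ← ofReal_mul, ← div_eq_mul_inv]
  · rw [mul_comm, Real.volume_real_Ioo_of_le (by linarith [Real.pi_pos])]
    apply le_of_eq; ring

lemma norm_exp_tripleExp_le {κ : ℂ} (hκ : 0 < κ.re) {t : ℝ} (ht : 1 ≤ t) (p : ℝ × ℝ) :
    ‖cexp (-(κ * (t ^ (1 / 3 : ℝ) : ℝ)) * tripleExp p)‖ ≤ Real.exp (-κ.re * tripleExp p) := by
  rw [Complex.norm_exp]
  have h1 : (1 : ℝ) ≤ t ^ (1 / 3 : ℝ) := Real.one_le_rpow ht (by norm_num)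
  have h2 := three_le_tripleExp p
  simp only [neg_mul, neg_re, re_mul_ofReal, Real.exp_le_exp, neg_le_neg_iff]
  have : 0 < κ.re * tripleExp p := by positivity
  nlinarith

lemma integrable_mul_exp_tripleExp {κ : ℂ} (hκ : 0 < κ.re) {Y x C : ℝ} (hY : 1 ≤ Y)
    {h : ℝ → ℝ} (hm : Measurable h) (hC : ∀ t ∈ Ioc Y x, |h t| ≤ C) {g : ℝ × ℝ → ℝ}
    (hg : Continuous g) (hg1 : ∀ p, |g p| ≤ 1) :
    Integrable (fun q : ℝ × (ℝ × ℝ) =>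
      (h q.1 : ℂ) * (g q.2 * cexp (-(κ * (q.1 ^ (1 / 3 : ℝ) : ℝ)) * tripleExp q.2)))
      ((volume.restrict (Ioc Y x)).prod volume) := by
  have hT := continuous_tripleExp
  have h1 : Integrable (fun _ : ℝ => C) (volume.restrict (Ioc Y x)) := by simp
  refine (h1.mul_prod (integrable_exp_neg_tripleExp hκ)).mono' ?_ ?_
  · refine Measurable.aestronglyMeasurable ?_
    have : Measurable tripleExp := hT.measurable
    have : Measurable g := hg.measurable
    fun_prop
  · have : ∀ᵐ q ∂((volume.restrict (Ioc Y x)).prod (volume : Measure (ℝ × ℝ))), q.1 ∈ Ioc Y x :=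
      Measure.quasiMeasurePreserving_fst.ae (ae_restrict_mem measurableSet_Ioc)
    filter_upwards [this] with q hq
    have h2 := norm_exp_tripleExp_le hκ (hY.trans hq.1.le) q.2
    have h3 := hC _ hq
    rw [norm_mul, norm_mul, norm_real, norm_real, Real.norm_eq_abs, Real.norm_eq_abs]
    calc _ ≤ C * (1 * Real.exp (-κ.re * tripleExp q.2)) := by
          gcongr
          · exact (abs_nonneg _).trans h3
          · exact hg1 _
      _ = _ := by rw [one_mul]

lemma integral_mul_integral_tripleExp_swap {κ : ℂ} (hκ : 0 < κ.re) {Y x C : ℝ} (hY : 1 ≤ Y)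
    {h : ℝ → ℝ} (hm : Measurable h) (hC : ∀ t ∈ Ioc Y x, |h t| ≤ C) {g : ℝ × ℝ → ℝ}
    (hg : Continuous g) (hg1 : ∀ p, |g p| ≤ 1) :
    ∫ t in Ioc Y x, (h t : ℂ) * ∫ p, g p * cexp (-(κ * (t ^ (1 / 3 : ℝ) : ℝ)) * tripleExp p) =
      ∫ p, ∫ t in Ioc Y x,
        (h t : ℂ) * (g p * cexp (-(κ * (t ^ (1 / 3 : ℝ) : ℝ)) * tripleExp p)) := by
  simp_rw [← integral_const_mul]
  exact integral_integral_swap (integrable_mul_exp_tripleExp hκ hY hm hC hg hg1)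

lemma integral_mul_exp_rpow_by_parts {a : ℂ} (ha : a ≠ 0) {Y x : ℝ} (hY : 1 ≤ Y) (hx : Y ≤ x)
    {w : ℝ → ℝ} (hw : ContDiff ℝ 1 w) (hwY : w Y = 0) (hwx : w x = 0) :
    ∫ t in Ioc Y x, (w t : ℂ) * cexp (-(a * (t ^ (1 / 3 : ℝ) : ℝ))) =
      a⁻¹ * ∫ t in Ioc Y x,
        ((2 * t ^ (-1 / 3 : ℝ) * w t + 3 * t ^ (2 / 3 : ℝ) * deriv w t : ℝ) : ℂ) *
        cexp (-(a * (t ^ (1 / 3 : ℝ) : ℝ))) := by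
  have hpos : ∀ t ∈ uIcc Y x, 0 < t := fun t ht => by
    rw [uIcc_of_le hx] at ht
    linarith [ht.1]
  have cw : Continuous w := hw.continuous
  have cw' : Continuous (deriv w) := hw.continuous_deriv le_rfl
  have key := intervalIntegral.integral_mul_deriv_eq_deriv_mul (a := Y) (b := x)
    (u := fun t : ℝ => ((3 * t ^ (2 / 3 : ℝ) * w t : ℝ) : ℂ))
    (u' := fun t : ℝ => ((2 * t ^ (-1 / 3 : ℝ) * w t + 3 * t ^ (2 / 3 : ℝ) * deriv w t : ℝ) : ℂ))
    (v := fun t : ℝ => cexp (-(a * (t ^ (1 / 3 : ℝ) : ℝ))))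
    (v' := fun t : ℝ => cexp (-(a * (t ^ (1 / 3 : ℝ) : ℝ))) *
      (-(a * ((1 / 3) * t ^ (-2 / 3 : ℝ) : ℝ)))) ?_ ?_ ?_ ?_
  · simp only [hwY, hwx, mul_zero, ofReal_zero, zero_mul, sub_zero, zero_sub] at key
    rw [intervalIntegral.integral_of_le hx, intervalIntegral.integral_of_le hx] at key
    have e : ∫ t in Ioc Y x, ((3 * t ^ (2 / 3 : ℝ) * w t : ℝ) : ℂ) *
        (cexp (-(a * (t ^ (1 / 3 : ℝ) : ℝ))) * (-(a * ((1 / 3) * t ^ (-2 / 3 : ℝ) : ℝ)))) =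
        -a * ∫ t in Ioc Y x, (w t : ℂ) * cexp (-(a * (t ^ (1 / 3 : ℝ) : ℝ))) := by
      rw [← integral_const_mul]
      refine setIntegral_congr_fun measurableSet_Ioc fun t ht => ?_
      have ht0 : 0 < t := by linarith [ht.1]
      have h1 : t ^ (2 / 3 : ℝ) * t ^ (-2 / 3 : ℝ) = 1 := by
        rw [← Real.rpow_add ht0]; norm_num
      have h2 : ((t ^ (2 / 3 : ℝ) : ℝ) : ℂ) * ((t ^ (-2 / 3 : ℝ) : ℝ) : ℂ) = 1 := by
        exact_mod_cast h1
      push_cast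
      linear_combination (-a * (w t : ℂ) * cexp (-(a * (t ^ (1 / 3 : ℝ) : ℝ)))) * h2
    rw [e] at key
    rw [eq_inv_mul_iff_mul_eq₀ ha]
    linear_combination -key
  · intro t ht
    have h1 := Real.hasDerivAt_rpow_const (p := 2 / 3) (Or.inl (hpos t ht).ne')
    have h2 := ((h1.const_mul 3).mul
      ((hw.differentiable one_ne_zero).differentiableAt (x := t)).hasDerivAt).ofReal_comp
    refine h2.congr_deriv (congrArg _ ?_)
    rw [show (2 / 3 - 1 : ℝ) = -1 / 3 by norm_num]
    ring
  · intro t ht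
    have h1 := (Real.hasDerivAt_rpow_const (p := 1 / 3) (Or.inl (hpos t ht).ne')).ofReal_comp
    rw [show (1 / 3 - 1 : ℝ) = -2 / 3 by norm_num] at h1
    exact ((h1.const_mul a).neg).cexp
  · refine ContinuousOn.intervalIntegrable ?_
    refine continuous_ofReal.comp_continuousOn ?_
    refine ContinuousOn.add (ContinuousOn.mul (ContinuousOn.mul continuousOn_const ?_)
      cw.continuousOn) (ContinuousOn.mul (ContinuousOn.mul continuousOn_const ?_) cw'.continuousOn)
    · exact continuousOn_id.rpow_const fun t ht => Or.inl (hpos t ht).ne'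
    · exact continuousOn_id.rpow_const fun t ht => Or.inl (hpos t ht).ne'
  · refine ContinuousOn.intervalIntegrable ?_
    refine ContinuousOn.mul ?_ ?_
    · have : Continuous fun t : ℝ => t ^ (1 / 3 : ℝ) := Real.continuous_rpow_const (by norm_num)
      fun_prop
    · refine (continuousOn_const.mul (continuous_ofReal.comp_continuousOn
        (continuousOn_const.mul ?_))).neg
      exact continuousOn_id.rpow_const fun t ht => Or.inl (hpos t ht).ne'

lemma norm_integral_cutoff_le {Y x A B : ℝ} (hY : 1 ≤ Y) (hx : Y ≤ x) {w : ℝ → ℝ}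
    (hA : ∀ t ∈ Ioc Y x, |w t| ≤ A)
    (hB : ∀ t ∈ Ioc Y x, |deriv w t| ≤ B / Y)
    (h0 : ∀ t, 2 * Y < t → t < x - Y → deriv w t = 0) {F : ℝ → ℂ} {D : ℝ} (hD : 0 ≤ D)
    (hF : ∀ t ∈ Ioc Y x, ‖F t‖ ≤ D * t ^ (-1 / 3 : ℝ)) :
    ‖∫ t in Ioc Y x, ((2 * t ^ (-1 / 3 : ℝ) * w t + 3 * t ^ (2 / 3 : ℝ) * deriv w t : ℝ) : ℂ) *
      F t‖ ≤ D * (6 * (|A| + |B|) * x ^ (1 / 3 : ℝ)) := by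
  have hY0 : 0 < Y := by linarith
  have hx0 : 0 < x := by linarith
  have hxp : 0 < x ^ (1 / 3 : ℝ) := by positivity
  set S := Iic (2 * Y)
  set T := Ici (x - Y)
  set b : ℝ → ℝ := fun t => D * (2 * |A|) * t ^ (-2 / 3 : ℝ) +
    D * (3 * x ^ (1 / 3 : ℝ) * (|B| / Y)) * (S.indicator 1 t + T.indicator 1 t)
  have i1 : IntegrableOn (fun t : ℝ => t ^ (-2 / 3 : ℝ)) (Ioc Y x) :=
    (intervalIntegral.intervalIntegrable_rpow' (by norm_num)).1
  have i2 : IntegrableOn (S.indicator (1 : ℝ → ℝ)) (Ioc Y x) :=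
    (integrable_const (1 : ℝ)).indicator measurableSet_Iic
  have i3 : IntegrableOn (T.indicator (1 : ℝ → ℝ)) (Ioc Y x) :=
    (integrable_const (1 : ℝ)).indicator measurableSet_Ici
  refine (norm_integral_le_of_norm_le (g := b)
    ((i1.const_mul _).add ((i2.add i3).const_mul _)) ?_).trans ?_
  · filter_upwards [ae_restrict_mem measurableSet_Ioc] with t ht
    have ht0 : 0 < t := by linarith [ht.1]
    have e1 : t ^ (-1 / 3 : ℝ) * t ^ (-1 / 3 : ℝ) = t ^ (-2 / 3 : ℝ) := by
      rw [← Real.rpow_add ht0]; norm_num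
    have e2 : t ^ (2 / 3 : ℝ) * t ^ (-1 / 3 : ℝ) = t ^ (1 / 3 : ℝ) := by
      rw [← Real.rpow_add ht0]; norm_num
    have e3 : t ^ (1 / 3 : ℝ) ≤ x ^ (1 / 3 : ℝ) := by gcongr; exact ht.2
    have p1 : 0 < t ^ (-1 / 3 : ℝ) := by positivity
    have p2 : 0 < t ^ (2 / 3 : ℝ) := by positivity
    have hw' : |deriv w t| ≤ |B| / Y * (S.indicator 1 t + T.indicator 1 t) := by
      have n1 : 0 ≤ S.indicator (1 : ℝ → ℝ) t := indicator_nonneg (by simp) _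
      have n2 : 0 ≤ T.indicator (1 : ℝ → ℝ) t := indicator_nonneg (by simp) _
      have n3 : |deriv w t| ≤ |B| / Y := (hB t ht).trans (by gcongr; exact le_abs_self B)
      have n4 : 0 ≤ |B| / Y := by positivity
      rcases le_or_gt t (2 * Y) with h | h
      · have : S.indicator (1 : ℝ → ℝ) t = 1 := indicator_of_mem (mem_Iic.2 h) _
        rw [this]; nlinarith
      rcases le_or_gt (x - Y) t with h' | h'
      · have : T.indicator (1 : ℝ → ℝ) t = 1 := indicator_of_mem (mem_Ici.2 h') _
        rw [this]; nlinarith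
      · rw [h0 t h h', abs_zero]; positivity
    have hA' : |w t| ≤ |A| := (hA t ht).trans (le_abs_self A)
    rw [norm_mul, norm_real, Real.norm_eq_abs]
    have hV : |2 * t ^ (-1 / 3 : ℝ) * w t + 3 * t ^ (2 / 3 : ℝ) * deriv w t| ≤
        2 * t ^ (-1 / 3 : ℝ) * |A| + 3 * t ^ (2 / 3 : ℝ) *
          (|B| / Y * (S.indicator 1 t + T.indicator 1 t)) := by
      refine (abs_add_le _ _).trans ?_
      rw [abs_mul _ (w t), abs_mul _ (deriv w t),
      abs_of_pos (a := 2 * t ^ (-1 / 3 : ℝ)) (by positivity),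
      abs_of_pos (a := 3 * t ^ (2 / 3 : ℝ)) (by positivity)]
      gcongr
    have n1 : 0 ≤ S.indicator (1 : ℝ → ℝ) t := indicator_nonneg (by simp) _
    have n2 : 0 ≤ T.indicator (1 : ℝ → ℝ) t := indicator_nonneg (by simp) _
    calc _ ≤ (2 * t ^ (-1 / 3 : ℝ) * |A| + 3 * t ^ (2 / 3 : ℝ) *
          (|B| / Y * (S.indicator 1 t + T.indicator 1 t))) * (D * t ^ (-1 / 3 : ℝ)) :=
          mul_le_mul hV (hF t ht) (norm_nonneg _) (by positivity)
      _ = D * (2 * |A|) * (t ^ (-1 / 3 : ℝ) * t ^ (-1 / 3 : ℝ)) + D * (3 *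
          (t ^ (2 / 3 : ℝ) * t ^ (-1 / 3 : ℝ)) * (|B| / Y)) *
          (S.indicator 1 t + T.indicator 1 t) := by ring
      _ ≤ _ := by
          rw [e1, e2]
          simp only [b]
          gcongr
  · have j1 : ∫ t in Ioc Y x, t ^ (-2 / 3 : ℝ) ≤ 3 * x ^ (1 / 3 : ℝ) := by
      rw [← intervalIntegral.integral_of_le hx, integral_rpow (Or.inl (by norm_num))]
      have : 0 < Y ^ (1 / 3 : ℝ) := by positivity
      norm_num
      linarith
    have j2 : ∫ t in Ioc Y x, S.indicator (1 : ℝ → ℝ) t ≤ Y := by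
      rw [integral_indicator_one measurableSet_Iic, measureReal_restrict_apply measurableSet_Iic]
      calc volume.real (S ∩ Ioc Y x) ≤ volume.real (Ioc Y (2 * Y)) :=
            measureReal_mono (fun t ht => ⟨ht.2.1, ht.1⟩) (by simp)
        _ = Y := by rw [Real.volume_real_Ioc_of_le (by linarith)]; ring
    have j3 : ∫ t in Ioc Y x, T.indicator (1 : ℝ → ℝ) t ≤ Y := by
      rw [integral_indicator_one measurableSet_Ici, measureReal_restrict_apply measurableSet_Ici]
      calc volume.real (T ∩ Ioc Y x) ≤ volume.real (Icc (x - Y) x) :=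
            measureReal_mono (fun t ht => ⟨ht.1, ht.2.2⟩) (by simp)
        _ = Y := by rw [Real.volume_real_Icc_of_le (by linarith)]; ring
    simp only [b]
    have i4 : Integrable (fun t => S.indicator (1 : ℝ → ℝ) t + T.indicator (1 : ℝ → ℝ) t)
      (volume.restrict (Ioc Y x)) := i2.add i3
    rw [integral_add (i1.const_mul _) (i4.const_mul _), integral_const_mul,
      integral_const_mul, integral_add i2 i3]
    calc _ ≤ D * (2 * |A|) * (3 * x ^ (1 / 3 : ℝ)) +
          D * (3 * x ^ (1 / 3 : ℝ) * (|B| / Y)) * (Y + Y) := by gcongr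
      _ = _ := by field_simp; ring

/-- The smoothed integral of the double exponential integral, by parts in `t`. -/
lemma norm_integral_mul_integral_exp_tripleExp_le {κ : ℂ} (hκ : 0 < κ.re) {Y x A B : ℝ}
    (hY : 1 ≤ Y) (hx : Y ≤ x) {w : ℝ → ℝ} (hw : ContDiff ℝ 1 w) (hwY : w Y = 0) (hwx : w x = 0)
    (hA : ∀ t ∈ Ioc Y x, |w t| ≤ A) (hB : ∀ t ∈ Ioc Y x, |deriv w t| ≤ B / Y)
    (h0 : ∀ t, 2 * Y < t → t < x - Y → deriv w t = 0) :
    ‖∫ t in Ioc Y x, (w t : ℂ) * ∫ p, cexp (-(κ * (t ^ (1 / 3 : ℝ) : ℝ)) * tripleExp p)‖ ≤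
      2 * Real.pi * 35001 * (6 * (|A| + |B|)) * x ^ (1 / 3 : ℝ) / ‖κ‖ ^ 2 := by
  have hY0 : 0 < Y := by linarith
  have hκ0 : κ ≠ 0 := by rintro rfl; simp at hκ
  have hT := continuous_tripleExp
  have hTpos : ∀ p, 0 < tripleExp p := fun p => by linarith [three_le_tripleExp p]
  set V : ℝ → ℝ := fun t => 2 * t ^ (-1 / 3 : ℝ) * w t + 3 * t ^ (2 / 3 : ℝ) * deriv w t with hV
  have hVm : Measurable V := by
    have := hw.continuous.measurable
    have := measurable_deriv w
    fun_prop
  have hVC : ∀ t ∈ Ioc Y x, |V t| ≤ 2 * 1 * |A| + 3 * x ^ (2 / 3 : ℝ) * (|B| / Y) := fun t ht => by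
    have ht0 : 0 < t := by linarith [ht.1]
    have h1 : t ^ (-1 / 3 : ℝ) ≤ 1 :=
      Real.rpow_le_one_of_one_le_of_nonpos (hY.trans ht.1.le) (by norm_num)
    have h2 : t ^ (2 / 3 : ℝ) ≤ x ^ (2 / 3 : ℝ) := by gcongr; exact ht.2
    refine (abs_add_le _ _).trans ?_
    rw [abs_mul _ (w t), abs_mul _ (deriv w t),
      abs_of_pos (a := 2 * t ^ (-1 / 3 : ℝ)) (by positivity),
      abs_of_pos (a := 3 * t ^ (2 / 3 : ℝ)) (by positivity)]
    have h3 : |w t| ≤ |A| := (hA t ht).trans (le_abs_self A)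
    have h4 : |deriv w t| ≤ |B| / Y := (hB t ht).trans (by gcongr; exact le_abs_self B)
    have h5 : 0 < x := by linarith
    gcongr
  have s1 := integral_mul_integral_tripleExp_swap hκ hY hw.continuous.measurable hA
    (g := fun _ => 1) continuous_const (by simp)
  have s2 := integral_mul_integral_tripleExp_swap hκ hY hVm hVC (g := fun p => (tripleExp p)⁻¹)
    (hT.inv₀ fun p => (hTpos p).ne') (fun p => by
      rw [abs_of_pos (inv_pos.2 (hTpos p))]
      exact inv_le_one_of_one_le₀ (by linarith [three_le_tripleExp p]))
  have main : ∫ t in Ioc Y x, (w t : ℂ) *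
      ∫ p, cexp (-(κ * (t ^ (1 / 3 : ℝ) : ℝ)) * tripleExp p) =
      κ⁻¹ * ∫ t in Ioc Y x, (V t : ℂ) * ∫ p, ((tripleExp p)⁻¹ : ℝ) *
        cexp (-(κ * (t ^ (1 / 3 : ℝ) : ℝ)) * tripleExp p) := by
    simp only [ofReal_one, one_mul] at s1
    rw [s1, s2, ← integral_const_mul]
    refine integral_congr_ae (Eventually.of_forall fun p => ?_)
    have hp : (tripleExp p : ℂ) ≠ 0 := ofReal_ne_zero.2 (hTpos p).ne'
    have := integral_mul_exp_rpow_by_parts (mul_ne_zero hκ0 hp) hY hx hw hwY hwx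
    simp only
    have e : ∀ t : ℝ, -(κ * (t ^ (1 / 3 : ℝ) : ℝ)) * tripleExp p =
        -(κ * tripleExp p * (t ^ (1 / 3 : ℝ) : ℝ)) := fun t => by ring
    simp only [e]
    rw [this, mul_inv, mul_assoc, ← integral_const_mul]
    congr 1
    refine integral_congr_ae (Eventually.of_forall fun t => ?_)
    simp only [hV]
    push_cast
    ring
  have bd := norm_integral_cutoff_le hY hx hA hB h0 (D := 2 * Real.pi * (35001 / ‖κ‖))
    (F := fun t => ∫ p, ((tripleExp p)⁻¹ : ℝ) *
        cexp (-(κ * (t ^ (1 / 3 : ℝ) : ℝ)) * tripleExp p)) (by positivity) (fun t ht => by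
      have ht0 : 0 < t := by linarith [ht.1]
      have hp : 0 < t ^ (1 / 3 : ℝ) := by positivity
      refine (norm_integral_inv_tripleExp_mul_exp_le
        (by rw [re_mul_ofReal]; positivity)).trans (le_of_eq ?_)
      rw [norm_mul, norm_real, Real.norm_eq_abs, abs_of_pos hp, neg_div,
        Real.rpow_neg ht0.le]
      field_simp)
  rw [main, norm_mul, norm_inv]
  calc _ ≤ ‖κ‖⁻¹ * (2 * Real.pi * (35001 / ‖κ‖) * (6 * (|A| + |B|) * x ^ (1 / 3 : ℝ))) := by
        gcongr
    _ = _ := by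
        have := norm_pos_iff.2 hκ0
        field_simp

lemma integrableOn_mul_integral_exp_tripleExp {κ : ℂ} (hκ : 0 < κ.re) {Y x C : ℝ} (hY : 1 ≤ Y)
    {h : ℝ → ℝ} (hm : Measurable h) (hC : ∀ t ∈ Ioc Y x, |h t| ≤ C) :
    IntegrableOn (fun t : ℝ => (h t : ℂ) *
      ∫ p, cexp (-(κ * (t ^ (1 / 3 : ℝ) : ℝ)) * tripleExp p)) (Ioc Y x) := by
  have := (integrable_mul_exp_tripleExp hκ hY hm hC (g := fun _ => 1) continuous_const
    (by simp)).integral_prod_left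
  simp only [ofReal_one, one_mul, integral_const_mul] at this
  exact this

/-- The regularised kernel; `φ = π / 2` is the kernel of the transform. -/
noncomputable def gammaCos (φ l c t : ℝ) : ℂ :=
  Gamma (c + t * I) ^ 3 * (2 * Complex.cos (φ * (c + t * I))) ^ 3 * cexp (-(3 * l * (c + t * I)))

lemma gammaCos_eq (φ l c t : ℝ) : gammaCos φ l c t =
    gammaRot l (-φ) c t ^ 3 + 3 * gammaRot l (-φ / 3) c t ^ 3 + 3 * gammaRot l (φ / 3) c t ^ 3 +
      gammaRot l φ c t ^ 3 := by
  have h1 : ∀ θ : ℝ, gammaRot l θ c t ^ 3 =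
      Gamma (c + t * I) ^ 3 *
        (cexp (-(3 * θ * I * (c + t * I))) * cexp (-(3 * l * (c + t * I)))) := by
    intro θ
    rw [gammaRot, mul_pow, ← Complex.exp_nat_mul, ← Complex.exp_add, mul_comm]
    congr 2
    push_cast
    ring
  have e1 : ∀ z : ℂ, (2 * Complex.cos z) ^ 3 = cexp (3 * z * I) + 3 * cexp (z * I) +
      3 * cexp (-(z * I)) + cexp (-(3 * z * I)) := by
    intro z
    have h3 : cexp (3 * z * I) = cexp (z * I) ^ 3 := by
      rw [← Complex.exp_nat_mul]; congr 1; push_cast; ring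
    have h4 : cexp (-(3 * z * I)) = cexp (-(z * I)) ^ 3 := by
      rw [← Complex.exp_nat_mul]; congr 1; push_cast; ring
    have h5 : cexp (z * I) * cexp (-(z * I)) = 1 := by rw [← Complex.exp_add]; simp
    rw [Complex.two_cos, h3, h4, neg_mul]
    linear_combination (3 * cexp (z * I) + 3 * cexp (-(z * I))) * h5
  rw [h1, h1, h1, h1, gammaCos, e1]
  push_cast
  have e2 : -(3 * -(φ : ℂ) * I * (c + t * I)) = 3 * (φ * (c + t * I)) * I := by ring
  have e3 : -(3 * (-(φ : ℂ) / 3) * I * (c + t * I)) = (φ * (c + t * I)) * I := by ring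
  have e4 : -(3 * ((φ : ℂ) / 3) * I * (c + t * I)) = -((φ * (c + t * I)) * I) := by ring
  have e5 : -(3 * (φ : ℂ) * I * (c + t * I)) = -(3 * (φ * (c + t * I)) * I) := by ring
  rw [e2, e3, e4, e5]
  ring

lemma continuous_gammaCos {X : Type*} [TopologicalSpace X] {c : ℝ} (hc : 0 < c) {f g h : X → ℝ}
    (hf : Continuous f) (hg : Continuous g) (hh : Continuous h) :
    Continuous fun a => gammaCos (f a) (g a) c (h a) := by
  have h2 : Continuous fun a => Gamma (c + h a * I) := (continuous_Gamma_line hc).comp hh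
  unfold gammaCos
  have h3 := Complex.continuous_cos
  fun_prop

lemma integrable_gammaRot_pow_three (l : ℝ) {θ c : ℝ} (h1 : -(Real.pi / 2) < θ)
    (h2 : θ < Real.pi / 2) (hc : 0 < c) : Integrable fun t => gammaRot l θ c t ^ 3 := by
  obtain ⟨K, hK⟩ := norm_gammaRot_le l h1 h2 hc
  have hcont := continuous_gammaRot l θ hc
  refine ((integrable_gammaRot l h1 h2 hc).norm.const_mul (K ^ 2)).mono'
    (hcont.pow 3).aestronglyMeasurable (Eventually.of_forall fun t => ?_)
  rw [norm_pow, pow_succ]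
  gcongr
  exact hK t

lemma cexp_add_log_mul (l θ : ℝ) {t : ℝ} (ht : 0 < t) :
    cexp ((l + Real.log t / 3 : ℝ) + θ * I) = cexp (l + θ * I) * (t ^ (1 / 3 : ℝ) : ℝ) := by
  rw [Real.rpow_def_of_pos ht, Complex.ofReal_exp, ← Complex.exp_add]
  congr 1
  push_cast
  ring

lemma integral_add_three_mul {ν : Measure ℝ} {f₁ f₂ f₃ f₄ : ℝ → ℂ} (h₁ : Integrable f₁ ν)
    (h₂ : Integrable f₂ ν) (h₃ : Integrable f₃ ν) (h₄ : Integrable f₄ ν) :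
    ∫ t, (f₁ t + 3 * f₂ t + 3 * f₃ t + f₄ t) ∂ν =
      ∫ t, f₁ t ∂ν + 3 * ∫ t, f₂ t ∂ν + 3 * ∫ t, f₃ t ∂ν + ∫ t, f₄ t ∂ν := by
  have j₂ := h₂.const_mul 3
  have j₃ := h₃.const_mul 3
  have k₂ : Integrable (fun t => f₁ t + 3 * f₂ t) ν := h₁.add j₂
  have k₃ : Integrable (fun t => f₁ t + 3 * f₂ t + 3 * f₃ t) ν := k₂.add j₃
  rw [integral_add k₃ h₄, integral_add k₂ j₃, integral_add h₁ j₂, integral_const_mul,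
    integral_const_mul]

lemma integral_gammaCos {φ c : ℝ} (h1 : 0 < φ) (h2 : φ < Real.pi / 2) (hc : 0 < c) (l : ℝ) {t : ℝ}
    (ht : 0 < t) {S : ℝ → ℂ} (hS : ∀ θ, S θ =
      ∫ p, cexp (-(cexp (l + θ * I) * (t ^ (1 / 3 : ℝ) : ℝ)) * tripleExp p)) :
    ∫ s, gammaCos φ (l + Real.log t / 3) c s =
      2 * Real.pi * (S (-φ) + 3 * S (-φ / 3) + 3 * S (φ / 3) + S φ) := by
  have key : ∀ θ : ℝ, -(Real.pi / 2) < θ → θ < Real.pi / 2 →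
      ∫ s, gammaRot (l + Real.log t / 3) θ c s ^ 3 = 2 * Real.pi * S θ := by
    intro θ h1 h2
    rw [integral_gammaRot_pow_three _ h1 h2 hc, hS, cexp_add_log_mul l θ ht]
    rfl
  have ii := fun (θ : ℝ) (h1 : -(Real.pi / 2) < θ) (h2 : θ < Real.pi / 2) =>
    integrable_gammaRot_pow_three (l + Real.log t / 3) h1 h2 hc
  have i1 := ii (-φ) (by linarith) (by linarith)
  have i2 := ii (-φ / 3) (by linarith) (by linarith)
  have i3 := ii (φ / 3) (by linarith) (by linarith)
  have i4 := ii φ (by linarith) (by linarith)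
  simp_rw [gammaCos_eq]
  rw [integral_add_three_mul i1 i2 i3 i4, key _ (by linarith) (by linarith),
    key _ (by linarith) (by linarith), key _ (by linarith) (by linarith),
    key _ (by linarith) (by linarith)]
  ring

lemma norm_integral_mul_integral_gammaCos_le {φ c : ℝ} (h1 : 0 < φ) (h2 : φ < Real.pi / 2)
    (hc : 0 < c) (l : ℝ) {Y x A B : ℝ}
    (hY : 1 ≤ Y) (hx : Y ≤ x) {w : ℝ → ℝ} (hw : ContDiff ℝ 1 w) (hwY : w Y = 0) (hwx : w x = 0)
    (hA : ∀ t ∈ Ioc Y x, |w t| ≤ A) (hB : ∀ t ∈ Ioc Y x, |deriv w t| ≤ B / Y)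
    (h0 : ∀ t, 2 * Y < t → t < x - Y → deriv w t = 0) :
    ‖∫ t in Ioc Y x, (w t : ℂ) * ∫ s, gammaCos φ (l + Real.log t / 3) c s‖ ≤
      2 * Real.pi * (8 * (2 * Real.pi * 35001 * (6 * (|A| + |B|)) * x ^ (1 / 3 : ℝ) /
        Real.exp l ^ 2)) := by
  set S : ℝ → ℝ → ℂ := fun t θ =>
    ∫ p, cexp (-(cexp (l + θ * I) * (t ^ (1 / 3 : ℝ) : ℝ)) * tripleExp p) with hS
  set D := 2 * Real.pi * 35001 * (6 * (|A| + |B|)) * x ^ (1 / 3 : ℝ) / Real.exp l ^ 2 with hD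
  have bd : ∀ θ : ℝ, -(Real.pi / 2) < θ → θ < Real.pi / 2 →
      ‖∫ t in Ioc Y x, (w t : ℂ) * S t θ‖ ≤ D := fun θ a b => by
    have := norm_integral_mul_integral_exp_tripleExp_le (cexp_re_pos l a b) hY hx hw hwY hwx
      hA hB h0
    have e : ‖cexp (l + θ * I)‖ = Real.exp l := by simp [Complex.norm_exp]
    rwa [e] at this
  have ii := fun (θ : ℝ) (a : -(Real.pi / 2) < θ) (b : θ < Real.pi / 2) =>
    integrableOn_mul_integral_exp_tripleExp (cexp_re_pos l a b) hY hw.continuous.measurable hA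
  have i1 := ii (-φ) (by linarith) (by linarith)
  have i2 := ii (-φ / 3) (by linarith) (by linarith)
  have i3 := ii (φ / 3) (by linarith) (by linarith)
  have i4 := ii φ (by linarith) (by linarith)
  have b1 := bd (-φ) (by linarith) (by linarith)
  have b2 := bd (-φ / 3) (by linarith) (by linarith)
  have b3 := bd (φ / 3) (by linarith) (by linarith)
  have b4 := bd φ (by linarith) (by linarith)
  have e : ∫ t in Ioc Y x, (w t : ℂ) * ∫ s, gammaCos φ (l + Real.log t / 3) c s =
      2 * Real.pi * ((∫ t in Ioc Y x, (w t : ℂ) * S t (-φ)) +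
        3 * (∫ t in Ioc Y x, (w t : ℂ) * S t (-φ / 3)) +
        3 * (∫ t in Ioc Y x, (w t : ℂ) * S t (φ / 3)) + ∫ t in Ioc Y x, (w t : ℂ) * S t φ) := by
    rw [← integral_add_three_mul i1 i2 i3 i4, ← integral_const_mul]
    refine setIntegral_congr_fun measurableSet_Ioc fun t ht => ?_
    have ht0 : 0 < t := by linarith [ht.1]
    rw [integral_gammaCos h1 h2 hc l ht0 (S := S t) (fun θ => rfl)]
    ring
  rw [e, norm_mul]
  have n1 : ‖(2 * Real.pi : ℂ)‖ = 2 * Real.pi := by simp [abs_of_pos Real.pi_pos]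
  rw [n1]
  gcongr
  refine (norm_add_le _ _).trans ?_
  refine (add_le_add_left ((norm_add_le _ _).trans
    (add_le_add_left (norm_add_le _ _) _)) _).trans ?_
  rw [norm_mul, norm_mul]
  simp only [Complex.norm_ofNat]
  linarith

lemma norm_sq_cos (a b : ℝ) : ‖Complex.cos (a + b * I)‖ ^ 2 = Real.cos a ^ 2 + Real.sinh b ^ 2 := by
  have h : Complex.cos (a + b * I) =
      (Real.cos a * Real.cosh b : ℝ) + (-(Real.sin a * Real.sinh b) : ℝ) * I := by
    rw [Complex.cos_add_mul_I]
    push_cast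
    ring
  rw [h, ← Complex.normSq_eq_norm_sq, Complex.normSq_add_mul_I]
  nlinarith [Real.sin_sq_add_cos_sq a, Real.cosh_sq b]

lemma norm_cos_mul_le {φ c : ℝ} (h1 : 0 ≤ φ) (h2 : φ ≤ Real.pi / 2) (hc : 0 < c) (hc' : c < 1 / 2)
    (t : ℝ) : ‖Complex.cos (φ * (c + t * I))‖ ≤
      3 / 2 * ‖Complex.cos ((Real.pi / 2 : ℝ) * (c + t * I))‖ := by
  have e : ∀ ψ : ℝ, (ψ : ℂ) * (c + t * I) = (ψ * c : ℝ) + (ψ * t : ℝ) * I := fun ψ => by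
    push_cast; ring
  refine le_of_sq_le_sq ?_ (by positivity)
  rw [mul_pow, e, e, norm_sq_cos, norm_sq_cos]
  have h3 : Real.sinh (φ * t) ^ 2 ≤ Real.sinh (Real.pi / 2 * t) ^ 2 := by
    rw [sq_le_sq, Real.abs_sinh, Real.abs_sinh, Real.sinh_le_sinh, abs_mul, abs_mul,
      abs_of_nonneg h1, abs_of_pos (by positivity : 0 < Real.pi / 2)]
    gcongr
  have h4 : √2 / 2 ≤ Real.cos (Real.pi / 2 * c) := by
    rw [← Real.cos_pi_div_four]
    have := Real.pi_pos
    apply Real.cos_le_cos_of_nonneg_of_le_pi <;> nlinarith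
  have h5 : (√2 / 2) ^ 2 ≤ Real.cos (Real.pi / 2 * c) ^ 2 := by gcongr
  have h6 : (√2 / 2) ^ 2 = 1 / 2 := by rw [div_pow, Real.sq_sqrt (by norm_num)]; norm_num
  nlinarith [Real.cos_sq_le_one (φ * c), sq_nonneg (Real.sinh (Real.pi / 2 * t))]

lemma norm_gammaCos_le {φ c : ℝ} (h1 : 0 ≤ φ) (h2 : φ ≤ Real.pi / 2) (hc : 0 < c) (hc' : c < 1 / 2)
    (l t : ℝ) : ‖gammaCos φ l c t‖ ≤ 4 * ‖gammaCos (Real.pi / 2) l c t‖ := by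
  have := norm_cos_mul_le h1 h2 hc hc' t
  simp only [gammaCos, norm_mul, norm_pow]
  have h3 : ‖Complex.cos (φ * (c + t * I))‖ ^ 3 ≤
      (3 / 2 * ‖Complex.cos ((Real.pi / 2 : ℝ) * (c + t * I))‖) ^ 3 := by gcongr
  have h4 : (‖(2 : ℂ)‖ * ‖Complex.cos (φ * (c + t * I))‖) ^ 3 ≤
      4 * (‖(2 : ℂ)‖ * ‖Complex.cos ((Real.pi / 2 : ℝ) * (c + t * I))‖) ^ 3 := by
    rw [mul_pow] at h3 ⊢
    rw [mul_pow]
    have := pow_nonneg (norm_nonneg (Complex.cos ((Real.pi / 2 : ℝ) * (c + t * I)))) 3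
    have h5 : 0 ≤ ‖(2 : ℂ)‖ ^ 3 := by positivity
    nlinarith
  have h5 := norm_nonneg (cexp (-(3 * l * (c + t * I))))
  have h6 := pow_nonneg (norm_nonneg (Gamma (c + t * I))) 3
  calc _ ≤ ‖Gamma (c + t * I)‖ ^ 3 *
        (4 * (‖(2 : ℂ)‖ * ‖Complex.cos ((Real.pi / 2 : ℝ) * (c + t * I))‖) ^ 3) *
        ‖cexp (-(3 * l * (c + t * I)))‖ := by gcongr
    _ = _ := by ring

lemma gammaCos_eq_exp_mul (φ l c t : ℝ) :
    gammaCos φ l c t = cexp (-(3 * l * (c + t * I))) * gammaCos φ 0 c t := by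
  simp only [gammaCos, ofReal_zero, mul_zero, zero_mul, neg_zero, Complex.exp_zero, mul_one]
  ring

lemma norm_gammaCos_eq (φ l c t : ℝ) :
    ‖gammaCos φ l c t‖ = Real.exp (-(3 * l * c)) * ‖gammaCos φ 0 c t‖ := by
  rw [gammaCos_eq_exp_mul, norm_mul, Complex.norm_exp]
  simp

lemma norm_integral_mul_integral_gammaCos_pi_le {c : ℝ} (hc : 0 < c) (hc' : c < 1 / 2) (l : ℝ)
    {Y x A B : ℝ} (hY : 1 ≤ Y) (hx : Y ≤ x) {w : ℝ → ℝ} (hw : ContDiff ℝ 1 w) (hwY : w Y = 0)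
    (hwx : w x = 0) (hA : ∀ t ∈ Ioc Y x, |w t| ≤ A) (hB : ∀ t ∈ Ioc Y x, |deriv w t| ≤ B / Y)
    (h0 : ∀ t, 2 * Y < t → t < x - Y → deriv w t = 0) :
    ‖∫ t in Ioc Y x, (w t : ℂ) * ∫ s, gammaCos (Real.pi / 2) (l + Real.log t / 3) c s‖ ≤
      2 * Real.pi * (8 * (2 * Real.pi * 35001 * (6 * (|A| + |B|)) * x ^ (1 / 3 : ℝ) /
        Real.exp l ^ 2)) := by
  have hx0 : 0 < x := by linarith
  by_cases hint : Integrable (gammaCos (Real.pi / 2) 0 c)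
  swap
  · have : ∀ m, ∫ s, gammaCos (Real.pi / 2) m c s = 0 := by
      intro m
      refine integral_undef fun h => hint ?_
      have h2 : Continuous (gammaCos (Real.pi / 2) 0 c) :=
        continuous_gammaCos hc continuous_const continuous_const continuous_id
      refine (h.norm.const_mul (Real.exp (3 * m * c))).mono' h2.aestronglyMeasurable
        (Eventually.of_forall fun s => ?_)
      rw [norm_gammaCos_eq _ m, ← mul_assoc, ← Real.exp_add, add_neg_cancel, Real.exp_zero, one_mul]
    simp only [this, mul_zero, integral_zero, norm_zero]
    positivity
  set ψ : ℕ → ℝ := fun k => Real.pi / 2 - 1 / ((k : ℝ) + 1) with hψ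
  have ψlim : Tendsto ψ atTop (𝓝 (Real.pi / 2)) := by
    simpa [hψ] using tendsto_one_div_add_atTop_nhds_zero_nat.const_sub (Real.pi / 2)
  have ψpos : ∀ k, 0 < ψ k := fun k => by
    have : 1 / ((k : ℝ) + 1) ≤ 1 := by
      rw [div_le_one (by positivity)]
      have : (0 : ℝ) ≤ k := by positivity
      linarith
    simp only [hψ]
    linarith [Real.pi_gt_three]
  have ψlt : ∀ k, ψ k < Real.pi / 2 := fun k => by
    have : 0 < 1 / ((k : ℝ) + 1) := by positivity
    simp only [hψ]
    linarith
  have dom : ∀ k m s, ‖gammaCos (ψ k) m c s‖ ≤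
      4 * (Real.exp (-(3 * m * c)) * ‖gammaCos (Real.pi / 2) 0 c s‖) := fun k m s =>
    (norm_gammaCos_le (ψpos k).le (ψlt k).le hc hc' m s).trans_eq (by rw [norm_gammaCos_eq _ m])
  have domint : ∀ m, Integrable fun s =>
      4 * (Real.exp (-(3 * m * c)) * ‖gammaCos (Real.pi / 2) 0 c s‖) := fun m =>
    (hint.norm.const_mul _).const_mul _
  have lim1 : ∀ m, Tendsto (fun k => ∫ s, gammaCos (ψ k) m c s) atTop
      (𝓝 (∫ s, gammaCos (Real.pi / 2) m c s)) := fun m => by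
    refine tendsto_integral_of_dominated_convergence _ (fun k => ?_) (domint m)
      (fun k => Eventually.of_forall (dom k m)) (Eventually.of_forall fun s => ?_)
    · exact (continuous_gammaCos hc continuous_const continuous_const
        continuous_id).aestronglyMeasurable
    · exact ((continuous_gammaCos hc continuous_id continuous_const continuous_const).tendsto
        (Real.pi / 2)).comp ψlim
  have lim2 : Tendsto (fun k => ∫ t in Ioc Y x, (w t : ℂ) *
      ∫ s, gammaCos (ψ k) (l + Real.log t / 3) c s) atTop
      (𝓝 (∫ t in Ioc Y x, (w t : ℂ) * ∫ s, gammaCos (Real.pi / 2) (l + Real.log t / 3) c s)) := by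
    refine tendsto_integral_of_dominated_convergence
      (fun _ => A * (4 * (Real.exp (-(3 * l * c)) * ∫ s, ‖gammaCos (Real.pi / 2) 0 c s‖)))
      (fun k => ?_) (integrable_const _) (fun k => ?_) ?_
    · have h1 : StronglyMeasurable fun m : ℝ => ∫ s, gammaCos (ψ k) m c s := by
        have : Continuous fun q : ℝ × ℝ => gammaCos (ψ k) q.1 c q.2 :=
          continuous_gammaCos hc continuous_const continuous_fst continuous_snd
        exact this.stronglyMeasurable.integral_prod_right'
      have h2 : Measurable fun t : ℝ => l + Real.log t / 3 := by fun_prop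
      have h3 := h1.comp_measurable h2
      have h4 : StronglyMeasurable fun t : ℝ => (w t : ℂ) :=
        (continuous_ofReal.comp hw.continuous).stronglyMeasurable
      exact (h4.mul h3).aestronglyMeasurable
    · filter_upwards [ae_restrict_mem measurableSet_Ioc] with t ht
      rw [norm_mul, norm_real, Real.norm_eq_abs]
      have hlog : 0 ≤ Real.log t := Real.log_nonneg (hY.trans ht.1.le)
      refine mul_le_mul (hA t ht) ?_ (norm_nonneg _) ((abs_nonneg _).trans (hA t ht))
      refine (norm_integral_le_of_norm_le (domint _)
        (Eventually.of_forall (dom k (l + Real.log t / 3)))).trans ?_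
      rw [integral_const_mul, integral_const_mul]
      have : 0 ≤ ∫ s, ‖gammaCos (Real.pi / 2) 0 c s‖ := integral_nonneg fun _ => norm_nonneg _
      have h5 : 0 ≤ Real.log t * c := by positivity
      gcongr
      linarith
    · exact Eventually.of_forall fun t => (lim1 _).const_mul _
  exact le_of_tendsto lim2.norm (Eventually.of_forall fun k =>
    norm_integral_mul_integral_gammaCos_le (ψpos k) (ψlt k) hc l hY hx hw hwY hwx hA hB h0)

lemma Gamma_half_div_Gamma_half {s : ℂ} (h0 : 0 < s.re) (h1 : s.re < 1) :
    Gamma (s / 2) / Gamma ((1 - s) / 2) =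
      (Real.pi : ℂ) ^ (-1 / 2 : ℂ) * cexp (-(Real.log 2 * s)) * Gamma s *
        (2 * Complex.cos (Real.pi / 2 * s)) := by
  have hπ : (Real.pi : ℂ) ≠ 0 := ofReal_ne_zero.2 Real.pi_ne_zero
  have key := Complex.Gammaℝ_div_Gammaℝ_one_sub (s := s) (fun n h => by
    have := congrArg Complex.re h
    simp at this
    have : (0 : ℝ) ≤ n := by positivity
    linarith)
  rw [Gammaℝ_def, Gammaℝ_def, Gammaℂ_def, ← ofReal_ofNat,
    mul_cpow_ofReal_nonneg (by norm_num) Real.pi_pos.le,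
    mul_div_mul_comm, ← cpow_sub _ _ hπ] at key
  have e1 : (Real.pi : ℂ) ^ (-s / 2 - -(1 - s) / 2) *
      ((Real.pi : ℂ) ^ (-1 / 2 : ℂ) * (Real.pi : ℂ) ^ s)
      = 1 := by
    rw [← cpow_add _ _ hπ, ← cpow_add _ _ hπ]
    ring_nf
    simp
  have e2 : (Real.pi : ℂ) ^ s * (Real.pi : ℂ) ^ (-s) = 1 := by
    rw [← cpow_add _ _ hπ]; simp
  have e3 : (((2 : ℝ) : ℂ)) ^ (-s) = cexp (-(Real.log 2 * s)) := by
    rw [cpow_def_of_ne_zero (by norm_num), ← ofReal_log (by norm_num)]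
    ring_nf
  rw [e3, ofReal_ofNat] at key
  have e4 : (Real.pi : ℂ) / 2 * s = Real.pi * s / 2 := by ring
  rw [e4]
  calc _ = ((Real.pi : ℂ) ^ (-s / 2 - -(1 - s) / 2) *
      ((Real.pi : ℂ) ^ (-1 / 2 : ℂ) * (Real.pi : ℂ) ^ s)) *
      (Gamma (s / 2) / Gamma ((1 - s) / 2)) := by
        rw [e1, one_mul]
    _ = (Real.pi : ℂ) ^ (-1 / 2 : ℂ) * (Real.pi : ℂ) ^ s *
        ((Real.pi : ℂ) ^ (-s / 2 - -(1 - s) / 2) *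
        (Gamma (s / 2) / Gamma ((1 - s) / 2))) := by ring
    _ = _ := by
      rw [key]
      linear_combination (2 * (Real.pi : ℂ) ^ (-1 / 2 : ℂ) * cexp (-(Real.log 2 * s)) * Gamma s *
        Complex.cos (Real.pi * s / 2)) * e2

lemma U_eq {c X : ℝ} (hc : 0 < c) (hc' : c < 1) (hX : 0 < X) :
    U c X = 1 / (2 * Real.pi) * (((Real.pi : ℂ) ^ (-1 / 2 : ℂ)) ^ 3 *
      ∫ t, gammaCos (Real.pi / 2) (Real.log 2 + Real.log X / 3) c t) := by
  unfold U
  congr 1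
  rw [← integral_const_mul (((Real.pi : ℂ) ^ (-1 / 2 : ℂ)) ^ 3)
    (gammaCos (Real.pi / 2) (Real.log 2 + Real.log X / 3) c)]
  refine integral_congr_ae (Eventually.of_forall fun t => ?_)
  have hX' : (X : ℂ) ≠ 0 := ofReal_ne_zero.2 hX.ne'
  have e : cexp (-(3 * (Real.log 2 + Real.log X / 3 : ℝ) * (c + t * I))) =
      cexp (-(Real.log 2 * (c + t * I))) ^ 3 * cexp (Real.log X * -(c + t * I)) := by
    rw [← Complex.exp_nat_mul, ← Complex.exp_add]
    congr 1
    push_cast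
    ring
  simp only
  rw [Gamma_half_div_Gamma_half (by simpa) (by simpa), cpow_def_of_ne_zero hX',
    ← ofReal_log hX.le, gammaCos, e]
  push_cast
  ring

lemma rpow_le_exp_sq {q n : ℕ} (hq : 1 ≤ q) (hn : 1 ≤ n) :
    (n : ℝ) ^ (2 / 3 : ℝ) / q ^ 2 ≤
      Real.exp (Real.log 2 + Real.log (Real.pi ^ 3 * n / q ^ 3) / 3) ^ 2 := by
  have hq0 : (0 : ℝ) < q := by exact_mod_cast hq
  have hn0 : (0 : ℝ) < n := by exact_mod_cast hn
  have hπ := Real.pi_gt_three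
  have hN : 0 < Real.pi ^ 3 * n / q ^ 3 := by positivity
  have e : ∀ y : ℝ, 0 < y → (y ^ 3) ^ (2 / 3 : ℝ) = y ^ 2 := fun y hy => by
    rw [← Real.rpow_natCast, ← Real.rpow_mul hy.le, ← Real.rpow_natCast]
    norm_num
  have h1 : Real.exp (Real.log 2 + Real.log (Real.pi ^ 3 * n / q ^ 3) / 3) ^ 2 =
      4 * (Real.pi ^ 2 * (n ^ (2 / 3 : ℝ) / q ^ 2)) := by
    have : (Real.pi ^ 3 * n / q ^ 3) ^ (2 / 3 : ℝ) = Real.pi ^ 2 * (n ^ (2 / 3 : ℝ) / q ^ 2) := by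
      rw [Real.div_rpow (by positivity) (by positivity), Real.mul_rpow (by positivity)
        (by positivity), e _ (by positivity), e _ hq0, mul_div_assoc]
    rw [← this, Real.rpow_def_of_pos hN, Real.exp_add, Real.exp_log (by norm_num), mul_pow,
      ← Real.exp_nat_mul]
    norm_num
    ring
  rw [h1]
  have : 0 < (n : ℝ) ^ (2 / 3 : ℝ) / q ^ 2 := by positivity
  rw [← mul_assoc]
  exact le_mul_of_one_le_left this.le (by nlinarith)

lemma norm_what_le {c x Y A B : ℝ} {w : ℝ → ℝ} {q n : ℕ} (hc : 0 < c) (hc' : c < 1 / 2)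
    (hY : 1 ≤ Y) (hx : Y ≤ x) (hw : ContDiff ℝ 1 w) (hwY : ∀ t, 0 ≤ t → t ≤ Y → w t = 0)
    (hwx : ∀ t, x ≤ t → w t = 0) (hA : ∀ t ∈ Ioc Y x, |w t| ≤ A)
    (hB : ∀ t ∈ Ioc Y x, |deriv w t| ≤ B / Y)
    (h0 : ∀ t, 2 * Y < t → t < x - Y → deriv w t = 0) (hq : 1 ≤ q) (hn : 1 ≤ n) :
    ‖what c w q n‖ ≤ 8 * (2 * Real.pi * 35001 * (6 * (|A| + |B|))) * x ^ (1 / 3 : ℝ) * q ^ 2 /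
      n ^ (2 / 3 : ℝ) := by
  have hq0 : (0 : ℝ) < q := by exact_mod_cast hq
  have hn0 : (0 : ℝ) < n := by exact_mod_cast hn
  have hπ := Real.pi_pos
  have hx0 : 0 < x := by linarith
  set N := Real.pi ^ 3 * n / q ^ 3 with hN
  have hN0 : 0 < N := by positivity
  set l := Real.log 2 + Real.log N / 3 with hl
  have bd := norm_integral_mul_integral_gammaCos_pi_le hc hc' l hY hx hw
    (hwY Y (by linarith) le_rfl) (hwx x le_rfl) hA hB h0
  have e : what c w q n = 1 / (2 * Real.pi) * (((Real.pi : ℂ) ^ (-1 / 2 : ℂ)) ^ 3 *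
      ∫ t in Ioc Y x, (w t : ℂ) * ∫ s, gammaCos (Real.pi / 2) (l + Real.log t / 3) c s) := by
    rw [what, ← integral_const_mul, ← integral_const_mul,
      setIntegral_eq_of_subset_of_forall_sdiff_eq_zero measurableSet_Ioi
      (Ioc_subset_Ioi_self.trans (Ioi_subset_Ioi (by linarith : (0 : ℝ) ≤ Y)))]
    · refine setIntegral_congr_fun measurableSet_Ioc fun t ht => ?_
      have ht0 : 0 < t := by linarith [ht.1]
      rw [U_eq hc (by linarith) (by positivity), Real.log_mul hN0.ne' ht0.ne',
        show Real.log 2 + (Real.log N + Real.log t) / 3 = l + Real.log t / 3 by rw [hl]; ring]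
      ring
    · intro t ht
      have ht0 : 0 < t := ht.1
      have : w t = 0 := by
        rcases le_or_gt t Y with h | h
        · exact hwY t ht0.le h
        · exact hwx t (not_lt.1 fun h' => ht.2 ⟨h, h'.le⟩)
      simp [this]
  have n1 : ‖(1 / (2 * Real.pi) : ℂ)‖ = 1 / (2 * Real.pi) := by
    simp [abs_of_pos hπ]
  have n2 : ‖((Real.pi : ℂ) ^ (-1 / 2 : ℂ)) ^ 3‖ ≤ 1 := by
    rw [norm_pow, norm_cpow_eq_rpow_re_of_pos hπ]
    refine pow_le_one₀ (by positivity) (Real.rpow_le_one_of_one_le_of_nonpos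
      (by linarith [Real.pi_gt_three]) ?_)
    norm_num
  have hexp := rpow_le_exp_sq hq hn
  have hpos : 0 < (n : ℝ) ^ (2 / 3 : ℝ) / q ^ 2 := by positivity
  rw [e, norm_mul, norm_mul, n1]
  calc _ ≤ 1 / (2 * Real.pi) * (1 * (2 * Real.pi * (8 * (2 * Real.pi * 35001 *
        (6 * (|A| + |B|)) * x ^ (1 / 3 : ℝ) / Real.exp l ^ 2)))) := by gcongr
    _ ≤ 1 / (2 * Real.pi) * (1 * (2 * Real.pi * (8 * (2 * Real.pi * 35001 *
        (6 * (|A| + |B|)) * x ^ (1 / 3 : ℝ) / (n ^ (2 / 3 : ℝ) / q ^ 2))))) := by gcongr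
    _ = _ := by field_simp

lemma rpow_mul_sq_div_rpow_le {x : ℝ} {q n : ℕ} (hx : 0 < x) (hq : 1 ≤ q)
    (hn : (q : ℝ) ^ 3 / x ≤ n) :
    x ^ (1 / 3 : ℝ) * q ^ 2 / (n : ℝ) ^ (2 / 3 : ℝ) ≤ x := by
  have hq0 : (0 : ℝ) < q := by exact_mod_cast hq
  have h1 : ((q : ℝ) ^ 3 / x) ^ (2 / 3 : ℝ) ≤ (n : ℝ) ^ (2 / 3 : ℝ) := by gcongr
  have h2 : ((q : ℝ) ^ 3) ^ (2 / 3 : ℝ) = q ^ 2 := by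
    rw [← Real.rpow_natCast, ← Real.rpow_mul hq0.le, ← Real.rpow_natCast]
    norm_num
  have h3 : x ^ (1 / 3 : ℝ) * x ^ (2 / 3 : ℝ) = x := by
    rw [← Real.rpow_add hx]; norm_num
  rw [Real.div_rpow (by positivity) hx.le, h2, div_le_iff₀ (by positivity)] at h1
  have hn0 : (0 : ℝ) < n := lt_of_lt_of_le (by positivity) hn
  have : 0 < x ^ (1 / 3 : ℝ) := by positivity
  rw [div_le_iff₀ (by positivity)]
  calc x ^ (1 / 3 : ℝ) * q ^ 2 ≤ x ^ (1 / 3 : ℝ) * (n ^ (2 / 3 : ℝ) * x ^ (2 / 3 : ℝ)) := by gcongr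
    _ = x * n ^ (2 / 3 : ℝ) := by linear_combination (n : ℝ) ^ (2 / 3 : ℝ) * h3

end

/-- With `w` a smooth cutoff adapted to `(Y,x)` (with derivative
constants `Cd`), there is an absolute constant `K > 0` such that whenever the positive
integer `n` satisfies `n ≥ K·q³/x` (i.e. `n ≫ q³/x`), one has both
`ŵ_q(n) ≪_ε x^{1+ε}` (for every `ε > 0`) and `ŵ_q(n) ≪ x^{1/3} q²/n^{2/3}`. -/
theorem stmt16 (Cd : ℕ → ℝ) :
    ∃ K : ℝ, 0 < K ∧ ∃ C₂ : ℝ, 0 < C₂ ∧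
      ∀ ε : ℝ, 0 < ε → ∃ C₁ : ℝ, 0 < C₁ ∧
        ∀ c x Y : ℝ, ∀ w : ℝ → ℝ, ∀ q n : ℕ,
          0 < c → c < 1 / 6 → 1 ≤ Y → Y ≤ x →
          ContDiff ℝ (⊤ : ℕ∞) w →
          (∀ t : ℝ, 0 ≤ t → t ≤ Y → w t = 0) →
          (∀ t : ℝ, 2 * Y ≤ t → t ≤ x - Y → w t = 1) →
          (∀ t : ℝ, x ≤ t → w t = 0) →
          (∀ i : ℕ, ∀ t : ℝ, 0 ≤ t → |iteratedDeriv i w t| ≤ Cd i / Y ^ i) →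
          1 ≤ q → 1 ≤ n → K * (q : ℝ) ^ 3 / x ≤ (n : ℝ) →
          ‖what c w q n‖ ≤ C₁ * x ^ ((1 : ℝ) + ε) ∧
            ‖what c w q n‖ ≤ C₂ * x ^ ((1 : ℝ) / 3) * (q : ℝ) ^ 2 / (n : ℝ) ^ ((2 : ℝ) / 3) := by
  refine ⟨1, one_pos, 8 * (2 * Real.pi * 35001 * (6 * (|Cd 0| + |Cd 1|))) + 1, by positivity,
    fun ε hε => ⟨8 * (2 * Real.pi * 35001 * (6 * (|Cd 0| + |Cd 1|))) + 1, by positivity, ?_⟩⟩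
  intro c x Y w q n hc hc' hY hx hw hw0 hw1 hwx hd hq hn hK
  have hx1 : 1 ≤ x := hY.trans hx
  have hx0 : 0 < x := by linarith
  have hn0 : (0 : ℝ) < n := by exact_mod_cast hn
  have h0 : ∀ t, 2 * Y < t → t < x - Y → deriv w t = 0 := fun t h1 h2 => by
    have : w =ᶠ[nhds t] fun _ => 1 := by
      filter_upwards [Ioo_mem_nhds h1 h2] with s hs
      exact hw1 s hs.1.le hs.2.le
    rw [this.deriv_eq, deriv_const]
  have main := norm_what_le (A := Cd 0) (B := Cd 1) hc (by linarith) hY hx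
    (hw.of_le (by exact_mod_cast le_top)) hw0 hwx
    (fun t ht => by simpa using hd 0 t (by linarith [ht.1]))
    (fun t ht => by simpa using hd 1 t (by linarith [ht.1])) h0 hq hn
  have hpos : 0 ≤ x ^ (1 / 3 : ℝ) * q ^ 2 / (n : ℝ) ^ (2 / 3 : ℝ) := by positivity
  rw [one_mul] at hK
  have hle := rpow_mul_sq_div_rpow_le hx0 hq hK
  have hxε : x ≤ x ^ (1 + ε) := Real.self_le_rpow_of_one_le hx1 (by linarith)
  set D := 8 * (2 * Real.pi * 35001 * (6 * (|Cd 0| + |Cd 1|)))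
  have hD : 0 ≤ D := by positivity
  have main' : ‖what c w q n‖ ≤ (D + 1) * (x ^ (1 / 3 : ℝ) * q ^ 2 / (n : ℝ) ^ (2 / 3 : ℝ)) := by
    refine main.trans ?_
    rw [mul_assoc, mul_div_assoc]
    gcongr
    linarith
  refine ⟨main'.trans ?_, main'.trans_eq (by ring)⟩
  gcongr
  exact hle.trans hxε
end

section
/- Let 1 ≤ Y ≤ x, let w be a smooth cutoff as specified, let q ≥ 1, and suppose x²q³/Y³ ≥ x^{1/100}. Let ε > 0. Then for every positive integer n with n > (x²q³/Y³)^{1+ε}, one has |ŵ_q(n)| ≪_ε 1/(x^{100} n^{4/3}). -/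
open scoped BigOperators

open Complex in
theorem norm_betaIntegral_le (u v : ℂ) :
    ‖betaIntegral u v‖ ≤ ‖betaIntegral u.re v.re‖ := by
  have key : betaIntegral (u.re : ℂ) (v.re : ℂ) =
      ((∫ x in (0 : ℝ)..1, ‖(x : ℂ) ^ (u - 1) * (1 - (x : ℂ)) ^ (v - 1)‖ : ℝ) : ℂ) := by
    rw [← intervalIntegral.integral_ofReal]
    refine intervalIntegral.integral_congr_ae' ?_ (by simp)
    filter_upwards [MeasureTheory.Measure.ae_ne MeasureTheory.volume (1 : ℝ)] with x hx1 hx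
    have h0 : 0 < x := hx.1
    have h1 : 0 < 1 - x := sub_pos.mpr (lt_of_le_of_ne hx.2 hx1)
    have e : (1 - (x : ℂ)) = ((1 - x : ℝ) : ℂ) := by push_cast; rfl
    rw [norm_mul, e, norm_cpow_eq_rpow_re_of_pos h0, norm_cpow_eq_rpow_re_of_pos h1, ofReal_mul,
      ofReal_cpow h0.le, ofReal_cpow h1.le]
    simp
  rw [key, norm_real]
  exact (intervalIntegral.norm_integral_le_integral_norm zero_le_one).trans (le_abs_self _)

open Complex in
theorem norm_Gamma_mul_le {u : ℂ} {v : ℝ} (hu : 0 < u.re) (hv : 0 < v) :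
    ‖Gamma u‖ * Real.Gamma (u.re + v) ≤ ‖Gamma (u + v)‖ * Real.Gamma u.re := by
  have h1 := congrArg norm (Gamma_mul_Gamma_eq_betaIntegral (s := u) (t := v) hu (by simpa))
  have h2 := congrArg norm
    (Gamma_mul_Gamma_eq_betaIntegral (s := u.re) (t := v) (by simpa) (by simpa))
  have h3 : ‖betaIntegral u v‖ ≤ ‖betaIntegral u.re v‖ := by
    simpa using norm_betaIntegral_le u v
  have n : ∀ a : ℝ, 0 < a → ‖Gamma (a : ℂ)‖ = Real.Gamma a := fun a ha => by
    rw [Gamma_ofReal, norm_real, Real.norm_of_nonneg (Real.Gamma_pos_of_pos ha).le]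
  rw [norm_mul, norm_mul, n v hv] at h1
  rw [norm_mul, norm_mul, n v hv, n _ hu, ← ofReal_add, n _ (by positivity)] at h2
  have gv := Real.Gamma_pos_of_pos hv
  have guv : 0 < Real.Gamma (u.re + v) := Real.Gamma_pos_of_pos (by positivity)
  refine le_of_mul_le_mul_right ?_ gv
  calc _ = (‖Gamma u‖ * Real.Gamma v) * Real.Gamma (u.re + v) := by ring
    _ = ‖Gamma (u + v)‖ * ‖betaIntegral u v‖ * Real.Gamma (u.re + v) := by rw [h1]
    _ ≤ ‖Gamma (u + v)‖ * ‖betaIntegral u.re v‖ * Real.Gamma (u.re + v) := by gcongr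
    _ = ‖Gamma (u + v)‖ * (Real.Gamma (u.re + v) * ‖betaIntegral u.re v‖) := by ring
    _ = _ := by rw [← h2]; ring

open Complex in
theorem norm_Gamma_half_add_le (t : ℝ) :
    ‖Gamma (1 / 2 + t * I)‖ ≤ √(2 * Real.pi) * Real.exp (-(Real.pi * |t| / 2)) := by
  have h := Gamma_mul_Gamma_one_sub (1 / 2 + t * I)
  have e1 : (1 - (1 / 2 + t * I) : ℂ) = (starRingEnd ℂ) (1 / 2 + t * I) := by
    apply Complex.ext
    · simp
      norm_num
    · simp
  rw [e1, Gamma_conj, mul_conj,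
    show (Real.pi : ℂ) * (1 / 2 + t * I) = Real.pi * t * I + Real.pi / 2 by ring,
    sin_add_pi_div_two, cos_mul_I, ← ofReal_mul, ← ofReal_cosh, ← ofReal_div, ofReal_inj,
    normSq_eq_norm_sq] at h
  refine abs_le_of_sq_le_sq' ?_ (by positivity) |>.2
  rw [h, mul_pow, Real.sq_sqrt (by positivity), ← Real.exp_nat_mul,
    show ((2 : ℕ) : ℝ) * -(Real.pi * |t| / 2) = -|Real.pi * t| by
      rw [abs_mul, abs_of_pos Real.pi_pos]; push_cast; ring,
    div_le_iff₀ (Real.cosh_pos _), ← Real.cosh_abs (Real.pi * t), Real.cosh_eq, Real.exp_neg]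
  have := Real.exp_pos (|Real.pi * t|)
  have := Real.pi_pos
  field_simp
  nlinarith [sq_nonneg (Real.exp |Real.pi * t|)]

open Complex in
theorem norm_Gamma_nat_add_half_add_le (m : ℕ) (t : ℝ) :
    ‖Gamma (m + 1 / 2 + t * I)‖ ≤
      m.factorial * (1 + |t|) ^ m * (√(2 * Real.pi) * Real.exp (-(Real.pi * |t| / 2))) := by
  induction m with
  | zero => simpa using norm_Gamma_half_add_le t
  | succ m ih =>
    have hne : (m + 1 / 2 + t * I : ℂ) ≠ 0 := fun h => by
      have := congrArg re h
      simp at this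
      linarith [(Nat.cast_nonneg m : (0 : ℝ) ≤ m)]
    have hb : ‖(m + 1 / 2 + t * I : ℂ)‖ ≤ (m + 1) * (1 + |t|) := by
      have : ‖(m + 1 / 2 + t * I : ℂ)‖ ≤ (m + 1 / 2) + |t| := by
        refine (norm_add_le _ _).trans (add_le_add (le_of_eq ?_) (by simp))
        rw [show (m + 1 / 2 : ℂ) = ((m + 1 / 2 : ℝ) : ℂ) by push_cast; rfl, norm_real,
          Real.norm_of_nonneg (by positivity)]
      nlinarith [abs_nonneg t, mul_nonneg (Nat.cast_nonneg m : (0 : ℝ) ≤ m) (abs_nonneg t)]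
    rw [show ((m + 1 : ℕ) + 1 / 2 + t * I : ℂ) = (m + 1 / 2 + t * I) + 1 by push_cast; ring,
      Gamma_add_one _ hne, norm_mul]
    refine (mul_le_mul hb ih (norm_nonneg _) (by positivity)).trans (le_of_eq ?_)
    rw [Nat.factorial_succ]; push_cast; ring

open Complex in
theorem norm_cos_le_exp_abs_im (z : ℂ) : ‖cos z‖ ≤ Real.exp |z.im| := by
  have h : ‖2 * cos z‖ ≤ 2 * Real.exp |z.im| := by
    rw [two_cos]
    refine (norm_add_le _ _).trans ?_
    rw [norm_exp, norm_exp, two_mul]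
    gcongr <;> simp [neg_le_abs, le_abs_self]
  simpa using h

/-- The gamma quotient `Γ(s/2)/Γ((1-s)/2)`. -/
noncomputable def gammaQuotient (s : ℂ) : ℂ :=
  Complex.Gamma (s / 2) / Complex.Gamma ((1 - s) / 2)

open Complex in
theorem norm_gammaQuotient_eq {s : ℂ} (hs : 0 < s.re) :
    ‖gammaQuotient s‖ =
      Real.pi ^ (s.re - 1 / 2) * (2 * (2 * Real.pi) ^ (-s.re)) *
        (‖Gamma s‖ * ‖cos (Real.pi * s / 2)‖) := by
  have h := congrArg norm (Gammaℝ_div_Gammaℝ_one_sub (s := s) fun n h => by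
    have := congrArg re h
    simp at this
    linarith [(Nat.cast_nonneg n : (0 : ℝ) ≤ n)])
  have hpi := Real.pi_pos
  have e : (2 * Real.pi : ℂ) = ((2 * Real.pi : ℝ) : ℂ) := by push_cast; rfl
  rw [norm_div, Gammaℝ_def, Gammaℝ_def, norm_mul, norm_mul, norm_mul,
    norm_cpow_eq_rpow_re_of_pos hpi, norm_cpow_eq_rpow_re_of_pos hpi, Gammaℂ_def, norm_mul,
    norm_mul, e, norm_cpow_eq_rpow_re_of_pos (by positivity), mul_div_mul_comm, ← norm_div,
    ← Real.rpow_sub hpi] at h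
  have e2 : (-s / 2).re - (-(1 - s) / 2).re = 1 / 2 - s.re := by simp; ring
  rw [e2, show (1 / 2 - s.re) = -(s.re - 1 / 2) by ring, Real.rpow_neg hpi.le] at h
  have hp : 0 < Real.pi ^ (s.re - 1 / 2) := by positivity
  rw [inv_mul_eq_iff_eq_mul₀ hp.ne'] at h
  rw [gammaQuotient, h]
  simp
  ring

open Complex in
theorem exists_norm_gammaQuotient_le (m : ℕ) {a : ℝ} (ha : 0 < a) :
    ∃ K : ℝ, 0 < K ∧ ∀ s : ℂ, a ≤ s.re → s.re ≤ m →
      ‖gammaQuotient s‖ ≤ K * (1 + |s.im|) ^ m := by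
  have hpi := Real.pi_pos
  let k : ℝ → ℝ := fun σ => Real.pi ^ (σ - 1 / 2) * (2 * (2 * Real.pi) ^ (-σ)) *
    (Real.Gamma σ / Real.Gamma (m + 1 / 2) * (m.factorial * √(2 * Real.pi)))
  have hk : ContinuousOn k (Set.Icc a m) := by
    intro σ hσ
    have h0 : 0 < σ := ha.trans_le hσ.1
    have hG : ContinuousAt Real.Gamma σ :=
      (Real.differentiableAt_Gamma fun n => by
        have := (Nat.cast_nonneg n : (0 : ℝ) ≤ n)
        linarith).continuousAt
    have h1 : ContinuousAt (fun σ : ℝ => Real.pi ^ (σ - 1 / 2)) σ :=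
      ContinuousAt.rpow continuousAt_const (by fun_prop) (Or.inl hpi.ne')
    have h2 : ContinuousAt (fun σ : ℝ => (2 * Real.pi) ^ (-σ)) σ :=
      ContinuousAt.rpow continuousAt_const (by fun_prop) (Or.inl (by positivity))
    exact ((h1.mul (continuousAt_const.mul h2)).mul
      ((hG.div_const _).mul continuousAt_const)).continuousWithinAt
  obtain ⟨K, hK⟩ := isCompact_Icc.exists_bound_of_continuousOn hk
  refine ⟨max K 1, by positivity, fun s h1 h2 => ?_⟩
  have hs : 0 < s.re := ha.trans_le h1
  have hm : (0 : ℝ) < Real.Gamma (m + 1 / 2) := Real.Gamma_pos_of_pos (by positivity)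
  have hG : ‖Gamma s‖ ≤ Real.Gamma s.re / Real.Gamma (m + 1 / 2) *
      (m.factorial * (1 + |s.im|) ^ m * (√(2 * Real.pi) * Real.exp (-(Real.pi * |s.im| / 2)))) := by
    have h := norm_Gamma_mul_le (u := s) (v := m + 1 / 2 - s.re) hs (by linarith)
    have e : s + ((m + 1 / 2 - s.re : ℝ) : ℂ) = m + 1 / 2 + s.im * I := by
      apply Complex.ext <;> simp
    rw [e, add_sub_cancel] at h
    rw [div_mul_eq_mul_div, le_div_iff₀ hm]
    refine h.trans ?_
    rw [mul_comm]
    exact mul_le_mul_of_nonneg_left (norm_Gamma_nat_add_half_add_le m s.im)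
      (Real.Gamma_pos_of_pos hs).le
  have hc : ‖cos (Real.pi * s / 2)‖ ≤ Real.exp (Real.pi * |s.im| / 2) := by
    refine (norm_cos_le_exp_abs_im _).trans (le_of_eq ?_)
    congr 1
    have : (Real.pi * s / 2 : ℂ).im = Real.pi * s.im / 2 := by simp
    rw [this, abs_div, abs_mul, abs_of_pos hpi, abs_two]
  rw [norm_gammaQuotient_eq hs]
  have hGs := Real.Gamma_pos_of_pos hs
  calc _ ≤ Real.pi ^ (s.re - 1 / 2) * (2 * (2 * Real.pi) ^ (-s.re)) *
        (Real.Gamma s.re / Real.Gamma (m + 1 / 2) * (m.factorial * (1 + |s.im|) ^ m *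
          (√(2 * Real.pi) * Real.exp (-(Real.pi * |s.im| / 2)))) *
            Real.exp (Real.pi * |s.im| / 2)) := by gcongr
    _ = k s.re * (1 + |s.im|) ^ m *
        (Real.exp (-(Real.pi * |s.im| / 2)) * Real.exp (Real.pi * |s.im| / 2)) := by
      simp only [k]; ring
    _ = k s.re * (1 + |s.im|) ^ m := by rw [← Real.exp_add]; simp
    _ ≤ max K 1 * (1 + |s.im|) ^ m := by
      gcongr
      exact ((le_abs_self _).trans (hK _ ⟨h1, h2⟩)).trans (le_max_left _ _)

theorem differentiableAt_gammaQuotient {s : ℂ} (hs : 0 < s.re) :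
    DifferentiableAt ℂ gammaQuotient s := by
  have h1 : DifferentiableAt ℂ (fun s : ℂ => Complex.Gamma (s / 2)) s := by
    refine DifferentiableAt.comp s (Complex.differentiableAt_Gamma _ fun n h => ?_) (by fun_prop)
    have := congrArg Complex.re h
    simp at this
    linarith [(Nat.cast_nonneg n : (0 : ℝ) ≤ n)]
  have h2 : DifferentiableAt ℂ (fun s : ℂ => (Complex.Gamma ((1 - s) / 2))⁻¹) s :=
    DifferentiableAt.comp (g := fun s : ℂ => (Complex.Gamma s)⁻¹) (f := fun s : ℂ => (1 - s) / 2) s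
      (Complex.differentiable_one_div_Gamma _) (by fun_prop)
  have e : gammaQuotient =
      fun s => Complex.Gamma (s / 2) * (Complex.Gamma ((1 - s) / 2))⁻¹ := by
    funext s
    rw [gammaQuotient, div_eq_mul_inv]
  rw [e]
  exact h1.mul h2
section

open MeasureTheory Set Filter Topology

theorem integral_vertical_line_eq_of_norm_le {F : ℂ → ℂ} {a b M : ℝ} (hab : a ≤ b)
    (hF : ∀ s : ℂ, a ≤ s.re → s.re ≤ b → DifferentiableAt ℂ F s)
    (hM : ∀ s : ℂ, a ≤ s.re → s.re ≤ b → ‖F s‖ ≤ M * (1 + s.im ^ 2)⁻¹) :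
    ∫ t : ℝ, F (a + t * Complex.I) = ∫ t : ℝ, F (b + t * Complex.I) := by
  have hint : ∀ σ : ℝ, a ≤ σ → σ ≤ b → Integrable (fun t : ℝ => F (σ + t * Complex.I)) := by
    intro σ h1 h2
    refine (integrable_inv_one_add_sq.const_mul M).mono' (Continuous.aestronglyMeasurable ?_)
      (Eventually.of_forall fun t => ?_)
    · refine continuous_iff_continuousAt.mpr fun t => ?_
      exact ContinuousAt.comp (g := F) (hF _ (by simpa) (by simpa)).continuousAt (by fun_prop)
    · simpa using hM (σ + t * Complex.I) (by simpa) (by simpa)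
  have hlim : ∀ σ : ℝ, a ≤ σ → σ ≤ b →
      Tendsto (fun T : ℝ => ∫ t in (-T)..T, F (σ + t * Complex.I)) atTop
        (𝓝 (∫ t : ℝ, F (σ + t * Complex.I))) := fun σ h1 h2 =>
    intervalIntegral_tendsto_integral (hint σ h1 h2) tendsto_neg_atTop_atBot tendsto_id
  have h0 : Tendsto (fun T : ℝ => M * (1 + T ^ 2)⁻¹ * |b - a|) atTop (𝓝 0) := by
    have : Tendsto (fun T : ℝ => (1 + T ^ 2)⁻¹) atTop (𝓝 0) :=
      (tendsto_atTop_add_const_left _ _ (tendsto_pow_atTop two_ne_zero)).inv_tendsto_atTop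
    simpa using (this.const_mul M).mul_const |b - a|
  have hhor : ∀ τ T : ℝ, τ ^ 2 = T ^ 2 →
      ‖∫ σ in a..b, F (σ + τ * Complex.I)‖ ≤ M * (1 + T ^ 2)⁻¹ * |b - a| := by
    intro τ T hT
    refine intervalIntegral.norm_integral_le_of_norm_le_const fun σ hσ => ?_
    rw [uIoc_of_le hab] at hσ
    simpa [hT] using hM (σ + τ * Complex.I) (by simpa using hσ.1.le) (by simpa using hσ.2)
  have h1 : Tendsto (fun T : ℝ => ∫ σ in a..b, F (σ + ((-T : ℝ) : ℂ) * Complex.I)) atTop (𝓝 0) :=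
    squeeze_zero_norm (fun T => hhor (-T) T (by ring)) h0
  have h2 : Tendsto (fun T : ℝ => ∫ σ in a..b, F (σ + (T : ℂ) * Complex.I)) atTop (𝓝 0) :=
    squeeze_zero_norm (fun T => hhor T T rfl) h0
  have hrect : ∀ T : ℝ, (((∫ σ in a..b, F (σ + ((-T : ℝ) : ℂ) * Complex.I)) -
      ∫ σ in a..b, F (σ + (T : ℂ) * Complex.I)) +
      Complex.I • ∫ t in (-T)..T, F (b + t * Complex.I)) -
      Complex.I • ∫ t in (-T)..T, F (a + t * Complex.I) = 0 := by
    intro T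
    have := Complex.integral_boundary_rect_eq_zero_of_differentiableOn F
      (⟨a, -T⟩ : ℂ) (⟨b, T⟩ : ℂ) (by
        intro s hs
        rw [Complex.mem_reProdIm] at hs
        have h := hs.1
        rw [uIcc_of_le hab] at h
        exact (hF s h.1 h.2).differentiableWithinAt)
    simpa only using this
  have hl := (((h1.sub h2).add ((hlim b hab le_rfl).const_smul Complex.I)).sub
    ((hlim a le_rfl hab).const_smul Complex.I))
  simp only [hrect] at hl
  have := tendsto_nhds_unique hl tendsto_const_nhds
  rw [sub_zero, zero_add, ← smul_sub, smul_eq_zero] at this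
  exact (sub_eq_zero.mp (this.resolve_left Complex.I_ne_zero)).symm

section Mellin

variable {f : ℝ → ℝ} {Y x : ℝ}

theorem mellin_eq_intervalIntegral (hY : 0 < Y) (hYx : Y ≤ x)
    (h0 : ∀ t, 0 ≤ t → t ≤ Y → f t = 0) (h1 : ∀ t, x ≤ t → f t = 0) (z : ℂ) :
    mellin (fun t => (f t : ℂ)) z = ∫ t in Y..x, (t : ℂ) ^ (z - 1) * f t := by
  rw [mellin, intervalIntegral.integral_of_le hYx]
  refine setIntegral_eq_of_subset_of_forall_sdiff_eq_zero measurableSet_Ioi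
    (fun t ht => hY.trans ht.1) fun t ht => ?_
  have : f t = 0 := by
    rcases le_or_gt t Y with h | h
    · exact h0 t (le_of_lt ht.1) h
    · rcases le_or_gt x t with h' | h'
      · exact h1 t h'
      · exact absurd ⟨h, h'.le⟩ ht.2
  simp [this]

theorem norm_mellin_le (hY : 0 < Y) (hYx : Y ≤ x)
    (h0 : ∀ t, 0 ≤ t → t ≤ Y → f t = 0) (h1 : ∀ t, x ≤ t → f t = 0) {z : ℂ} {B P : ℝ}
    (hB : ∀ t, 0 ≤ t → |f t| ≤ B) (hP : ∀ t, Y ≤ t → t ≤ x → t ^ (z.re - 1) ≤ P) :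
    ‖mellin (fun t => (f t : ℂ)) z‖ ≤ P * B * x := by
  have hB0 : 0 ≤ B := (abs_nonneg _).trans (hB 0 le_rfl)
  have hP0 : 0 ≤ P := (Real.rpow_nonneg hY.le _).trans (hP Y le_rfl hYx)
  rw [mellin_eq_intervalIntegral hY hYx h0 h1]
  refine (intervalIntegral.norm_integral_le_of_norm_le_const (C := P * B) fun t ht => ?_).trans ?_
  · rw [uIoc_of_le hYx] at ht
    have ht0 : 0 < t := hY.trans ht.1
    rw [norm_mul, Complex.norm_cpow_eq_rpow_re_of_pos ht0, Complex.norm_real]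
    exact mul_le_mul (by simpa using hP t ht.1.le ht.2) (hB t ht0.le) (norm_nonneg _) hP0
  · rw [abs_of_nonneg (sub_nonneg.mpr hYx)]
    exact mul_le_mul_of_nonneg_left (by linarith) (by positivity)

theorem abs_im_mul_norm_mellin_le (hY : 0 < Y) (hYx : Y ≤ x) (hf : Differentiable ℝ f)
    (hf' : Continuous (deriv f))
    (h0 : ∀ t, 0 ≤ t → t ≤ Y → f t = 0) (h1 : ∀ t, x ≤ t → f t = 0)
    (h0' : ∀ t, 0 ≤ t → t ≤ Y → deriv f t = 0) (h1' : ∀ t, x ≤ t → deriv f t = 0) (z : ℂ) :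
    |z.im| * ‖mellin (fun t => (f t : ℂ)) z‖ ≤ ‖mellin (fun t => ((deriv f t : ℝ) : ℂ)) (z + 1)‖ := by
  rcases eq_or_ne z.im 0 with hz | hz
  · simp [hz]
  have hz0 : z ≠ 0 := fun h => hz (by simp [h])
  have hpos : ∀ t ∈ uIcc Y x, t ≠ 0 := fun t ht => by
    rw [uIcc_of_le hYx] at ht
    exact (hY.trans_le ht.1).ne'
  have hcont : ContinuousOn (fun t : ℝ => z * (t : ℂ) ^ (z - 1)) (uIcc Y x) := fun t ht =>
    (continuousAt_const.mul
      (Complex.continuousAt_ofReal_cpow_const t (z - 1) (Or.inr (hpos t ht)))).continuousWithinAt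
  have key := intervalIntegral.integral_mul_deriv_eq_deriv_mul (a := Y) (b := x)
    (u := fun t => (f t : ℂ)) (u' := fun t => ((deriv f t : ℝ) : ℂ))
    (v := fun t : ℝ => (t : ℂ) ^ z) (v' := fun t : ℝ => z * (t : ℂ) ^ (z - 1))
    (fun t _ => (hf t).hasDerivAt.ofReal_comp)
    (fun t ht => hasDerivAt_ofReal_cpow_const (hpos t ht) hz0)
    (Complex.continuous_ofReal.comp hf' |>.intervalIntegrable Y x) hcont.intervalIntegrable
  rw [h0 Y hY.le le_rfl, h1 x le_rfl] at key
  have h2 : z * mellin (fun t => (f t : ℂ)) z = -mellin (fun t => ((deriv f t : ℝ) : ℂ)) (z + 1) := by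
    rw [mellin_eq_intervalIntegral hY hYx h0 h1, mellin_eq_intervalIntegral hY hYx h0' h1',
      ← intervalIntegral.integral_const_mul]
    simp only [add_sub_cancel_right]
    simp only [Complex.ofReal_zero, zero_mul, sub_zero, zero_sub] at key
    refine Eq.trans (intervalIntegral.integral_congr fun t _ => ?_)
      (key.trans (congrArg Neg.neg (intervalIntegral.integral_congr fun t _ => ?_)))
    · show z * ((t : ℂ) ^ (z - 1) * f t) = f t * (z * (t : ℂ) ^ (z - 1))
      ring
    · exact mul_comm _ _
  rw [← norm_neg (mellin (fun t => ((deriv f t : ℝ) : ℂ)) (z + 1)), ← h2, norm_mul]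
  gcongr
  exact Complex.abs_im_le_norm z

theorem iteratedDeriv_eq_zero_of_eq_zero {w : ℝ → ℝ} (hw : ContDiff ℝ (⊤ : ℕ∞) w) (hY : 0 < Y)
    (h0 : ∀ t, 0 ≤ t → t ≤ Y → w t = 0) (h1 : ∀ t, x ≤ t → w t = 0) (k : ℕ) :
    (∀ t, 0 ≤ t → t ≤ Y → iteratedDeriv k w t = 0) ∧ ∀ t, x ≤ t → iteratedDeriv k w t = 0 := by
  have hc : Continuous (iteratedDeriv k w) :=
    hw.continuous_iteratedDeriv k (by exact_mod_cast le_top)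
  have hopen : ∀ U : Set ℝ, IsOpen U → (∀ t ∈ U, w t = 0) →
      ∀ t ∈ closure U, iteratedDeriv k w t = 0 := by
    intro U hU hz
    refine fun t ht => closure_minimal (fun t ht => ?_) (isClosed_eq hc continuous_const) ht
    have : w =ᶠ[𝓝 t] fun _ => (0 : ℝ) := by
      filter_upwards [hU.mem_nhds ht] with u hu using hz u hu
    show iteratedDeriv k w t = 0
    rw [this.iteratedDeriv_eq]
    simp
  constructor
  · intro t h h'
    refine hopen (Ioo 0 Y) isOpen_Ioo (fun t ht => h0 t ht.1.le ht.2.le) t ?_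
    rw [closure_Ioo hY.ne]
    exact ⟨h, h'⟩
  · intro t h
    refine hopen (Ioi x) isOpen_Ioi (fun t ht => h1 t (le_of_lt ht)) t ?_
    rw [closure_Ioi]
    exact h

theorem abs_im_pow_mul_norm_mellin_le {w : ℝ → ℝ} (hw : ContDiff ℝ (⊤ : ℕ∞) w) (hY : 0 < Y)
    (hYx : Y ≤ x) (h0 : ∀ t, 0 ≤ t → t ≤ Y → w t = 0) (h1 : ∀ t, x ≤ t → w t = 0) (k : ℕ)
    (z : ℂ) : |z.im| ^ k * ‖mellin (fun t => (w t : ℂ)) z‖ ≤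
      ‖mellin (fun t => ((iteratedDeriv k w t : ℝ) : ℂ)) (z + k)‖ := by
  induction k with
  | zero => simp
  | succ k ih =>
    have hz := iteratedDeriv_eq_zero_of_eq_zero hw hY h0 h1
    have hs := abs_im_mul_norm_mellin_le hY hYx
      (hw.differentiable_iteratedDeriv k (by exact_mod_cast ENat.natCast_lt_top k))
      (by
        rw [← iteratedDeriv_succ]
        exact hw.continuous_iteratedDeriv (k + 1) (by exact_mod_cast le_top))
      (hz k).1 (hz k).2 (by rw [← iteratedDeriv_succ]; exact (hz (k + 1)).1)
      (by rw [← iteratedDeriv_succ]; exact (hz (k + 1)).2) (z + k)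
    rw [← iteratedDeriv_succ] at hs
    calc _ = |z.im| * (|z.im| ^ k * ‖mellin (fun t => (w t : ℂ)) z‖) := by ring
      _ ≤ |z.im| * ‖mellin (fun t => ((iteratedDeriv k w t : ℝ) : ℂ)) (z + k)‖ := by gcongr
      _ ≤ _ := by simpa [add_assoc] using hs

theorem one_add_abs_im_pow_mul_norm_mellin_le {w : ℝ → ℝ} (hw : ContDiff ℝ (⊤ : ℕ∞) w)
    (hY : 0 < Y) (hYx : Y ≤ x) (h0 : ∀ t, 0 ≤ t → t ≤ Y → w t = 0) (h1 : ∀ t, x ≤ t → w t = 0)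
    {k : ℕ} {s : ℂ} (hsk : s.re ≤ k) {B C : ℝ}
    (hB : ∀ t, 0 ≤ t → |w t| ≤ B) (hC : ∀ t, 0 ≤ t → |iteratedDeriv k w t| ≤ C / Y ^ k) :
    (1 + |s.im|) ^ k * ‖mellin (fun t => (w t : ℂ)) (1 - s)‖ ≤
      2 ^ k * ((B + C) * (x * x ^ (k - s.re) / Y ^ k)) := by
  have hx : 0 < x := hY.trans_le hYx
  have hB0 : 0 ≤ B := (abs_nonneg _).trans (hB 0 le_rfl)
  have hmono : ∀ t, Y ≤ t → t ≤ x → t ^ (k - s.re) ≤ x ^ (k - s.re) := fun t ht ht' =>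
    Real.rpow_le_rpow (hY.le.trans ht) ht' (sub_nonneg.mpr hsk)
  have ha : ‖mellin (fun t => (w t : ℂ)) (1 - s)‖ ≤ x ^ (k - s.re) / Y ^ k * B * x := by
    refine norm_mellin_le hY hYx h0 h1 hB fun t ht ht' => ?_
    have ht0 : 0 < t := hY.trans_le ht
    rw [le_div_iff₀ (by positivity)]
    calc t ^ ((1 - s).re - 1) * Y ^ k ≤ t ^ ((1 - s).re - 1) * t ^ k := by gcongr
      _ = t ^ (k - s.re) := by
        rw [← Real.rpow_natCast, ← Real.rpow_add ht0]; congr 1; simp; ring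
      _ ≤ _ := hmono t ht ht'
  have hz := iteratedDeriv_eq_zero_of_eq_zero hw hY h0 h1 k
  have hb : |s.im| ^ k * ‖mellin (fun t => (w t : ℂ)) (1 - s)‖ ≤
      x ^ (k - s.re) * (C / Y ^ k) * x := by
    have := abs_im_pow_mul_norm_mellin_le hw hY hYx h0 h1 k (1 - s)
    simp only [Complex.sub_im, Complex.one_im, zero_sub, abs_neg] at this
    refine this.trans (norm_mellin_le hY hYx hz.1 hz.2 hC fun t ht ht' => ?_)
    refine le_trans (le_of_eq ?_) (hmono t ht ht')
    congr 1; simp; ring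
  have hp : (1 + |s.im|) ^ k ≤ 2 ^ k * (1 + |s.im| ^ k) := by
    refine (add_pow_le zero_le_one (abs_nonneg _) k).trans ?_
    rw [one_pow]
    gcongr
    · norm_num
    · omega
  calc _ ≤ 2 ^ k * (1 + |s.im| ^ k) * ‖mellin (fun t => (w t : ℂ)) (1 - s)‖ := by gcongr
    _ = 2 ^ k * (‖mellin (fun t => (w t : ℂ)) (1 - s)‖ +
        |s.im| ^ k * ‖mellin (fun t => (w t : ℂ)) (1 - s)‖) := by ring
    _ ≤ 2 ^ k * (x ^ (k - s.re) / Y ^ k * B * x + x ^ (k - s.re) * (C / Y ^ k) * x) := by gcongr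
    _ = _ := by ring

theorem differentiable_mellin_of_eq_zero (hf : Continuous f) (hY : 0 < Y)
    (h0 : ∀ t, 0 ≤ t → t ≤ Y → f t = 0) (h1 : ∀ t, x ≤ t → f t = 0) :
    Differentiable ℂ (mellin fun t => (f t : ℂ)) := by
  intro z
  refine mellin_differentiableAt_of_isBigO_rpow (a := z.re + 1) (b := z.re - 1)
    ((Complex.continuous_ofReal.comp hf).locallyIntegrable.locallyIntegrableOn _)
    ?_ (by linarith) ?_ (by linarith)
  · refine (Asymptotics.isBigO_zero _ _).congr' ?_ EventuallyEq.rfl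
    filter_upwards [eventually_ge_atTop x] with t ht
    simp [h1 t ht]
  · refine (Asymptotics.isBigO_zero _ _).congr' ?_ EventuallyEq.rfl
    filter_upwards [Ioo_mem_nhdsGT hY] with t ht
    simp [h0 t ht.1.le ht.2.le]

theorem integral_mul_integral_cpow_eq_mellin (hf : Continuous f) (hY : 0 < Y)
    (h0 : ∀ t, 0 ≤ t → t ≤ Y → f t = 0) (h1 : ∀ t, x ≤ t → f t = 0) {N : ℝ} (hN : 0 < N)
    (c : ℝ) {g : ℝ → ℂ} (hg : Integrable g) :
    ∫ t in Ioi (0 : ℝ), (f t : ℂ) *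
        ∫ τ : ℝ, g τ * ((N * t : ℝ) : ℂ) ^ (-((c : ℂ) + (τ : ℂ) * Complex.I)) =
      ∫ τ : ℝ, g τ * (N : ℂ) ^ (-((c : ℂ) + (τ : ℂ) * Complex.I)) *
        mellin (fun t => (f t : ℂ)) (1 - ((c : ℂ) + (τ : ℂ) * Complex.I)) := by
  have hfi : IntegrableOn (fun t : ℝ => ‖(f t : ℂ)‖ * (N * t) ^ (-c)) (Ioi 0) := by
    have : IntegrableOn (fun t : ℝ => ‖(f t : ℂ)‖ * (N * t) ^ (-c)) (Icc Y x) := by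
      refine ContinuousOn.integrableOn_Icc fun t ht => ContinuousAt.continuousWithinAt ?_
      have ht0 : 0 < t := hY.trans_le ht.1
      exact (Complex.continuous_ofReal.comp hf).norm.continuousAt.mul
        (ContinuousAt.rpow (by fun_prop) continuousAt_const (Or.inl (by positivity)))
    refine this.of_forall_sdiff_eq_zero measurableSet_Ioi fun t ht => ?_
    have : f t = 0 := by
      rcases le_or_gt t Y with h | h
      · exact h0 t (le_of_lt ht.1) h
      · rcases le_or_gt x t with h' | h'
        · exact h1 t h'
        · exact absurd ⟨h.le, h'.le⟩ ht.2
    simp [this]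
  simp_rw [← integral_const_mul]
  rw [integral_integral_swap]
  · refine integral_congr_ae (Eventually.of_forall fun τ => ?_)
    simp only [mellin]
    rw [← integral_const_mul]
    refine setIntegral_congr_fun measurableSet_Ioi fun t ht => ?_
    have ht0 : (0 : ℝ) < t := ht
    simp only [smul_eq_mul]
    rw [Complex.ofReal_mul, Complex.mul_cpow_ofReal_nonneg hN.le ht0.le,
      show (1 - ((c : ℂ) + (τ : ℂ) * Complex.I) - 1) = -((c : ℂ) + (τ : ℂ) * Complex.I) by ring]
    ring
  · refine (hfi.mul_prod hg.norm).mono' ?_ ?_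
    · refine AEStronglyMeasurable.mul ?_ (AEStronglyMeasurable.mul ?_ ?_)
      · exact ((Complex.continuous_ofReal.comp hf).comp continuous_fst).aestronglyMeasurable
      · exact hg.aestronglyMeasurable.comp_snd
      · refine Measurable.aestronglyMeasurable ?_
        exact Measurable.pow (by fun_prop) (by fun_prop)
    · have hae : ∀ᵐ p : ℝ × ℝ ∂((volume.restrict (Ioi (0 : ℝ))).prod volume), 0 < p.1 :=
        Measure.quasiMeasurePreserving_fst.ae (ae_restrict_mem measurableSet_Ioi)
      filter_upwards [hae] with p hp
      simp only [Function.uncurry]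
      rw [norm_mul, norm_mul, Complex.norm_cpow_eq_rpow_re_of_pos (by positivity)]
      refine le_of_eq ?_
      simp
      ring

end Mellin

/-- The integrand of the Mellin–Barnes representation of `what`. -/
noncomputable def mellinBarnesIntegrand (w : ℝ → ℝ) (N : ℝ) (s : ℂ) : ℂ :=
  gammaQuotient s ^ 3 * (N : ℂ) ^ (-s) * mellin (fun t => (w t : ℂ)) (1 - s)

theorem exists_norm_mellinBarnesIntegrand_le (m : ℕ) {a : ℝ} (ha : 0 < a) :
    ∃ K : ℝ, 0 < K ∧ ∀ (w : ℝ → ℝ) (x Y B C N : ℝ), ContDiff ℝ (⊤ : ℕ∞) w → 0 < Y → Y ≤ x →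
      (∀ t, 0 ≤ t → t ≤ Y → w t = 0) → (∀ t, x ≤ t → w t = 0) → 0 < N →
      (∀ t, 0 ≤ t → |w t| ≤ B) →
      (∀ t, 0 ≤ t → |iteratedDeriv (3 * m + 2) w t| ≤ C / Y ^ (3 * m + 2)) →
      ∀ s : ℂ, a ≤ s.re → s.re ≤ m → ‖mellinBarnesIntegrand w N s‖ ≤
        K * (B + C) * (N ^ (-s.re) * (x * x ^ ((3 * m + 2 : ℕ) - s.re) / Y ^ (3 * m + 2))) *
          (1 + s.im ^ 2)⁻¹ := by
  obtain ⟨K, hK, hbound⟩ := exists_norm_gammaQuotient_le m ha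
  refine ⟨K ^ 3 * 2 ^ (3 * m + 2), by positivity, ?_⟩
  intro w x Y B C N hw hY hYx h0 h1 hN hB hC s hs hsm
  have hmn : (m : ℝ) ≤ (3 * m + 2 : ℕ) := by exact_mod_cast (by omega : m ≤ 3 * m + 2)
  have hW := one_add_abs_im_pow_mul_norm_mellin_le hw hY hYx h0 h1 (hsm.trans hmn) hB hC
  have hG := hbound s hs hsm
  set W := ‖mellin (fun t => (w t : ℂ)) (1 - s)‖
  set R := (B + C) * (x * x ^ ((3 * m + 2 : ℕ) - s.re) / Y ^ (3 * m + 2))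
  have hT : 0 < 1 + |s.im| := by positivity
  have hsq : 1 + s.im ^ 2 ≤ (1 + |s.im|) ^ 2 := by
    nlinarith [abs_nonneg s.im, sq_abs s.im]
  rw [mellinBarnesIntegrand, norm_mul, norm_mul, norm_pow, Complex.norm_cpow_eq_rpow_re_of_pos hN,
    Complex.neg_re]
  rw [← div_eq_mul_inv, le_div_iff₀ (by positivity)]
  calc ‖gammaQuotient s‖ ^ 3 * N ^ (-s.re) * W * (1 + s.im ^ 2)
      ≤ (K * (1 + |s.im|) ^ m) ^ 3 * N ^ (-s.re) * W * (1 + |s.im|) ^ 2 := by gcongr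
    _ = K ^ 3 * N ^ (-s.re) * ((1 + |s.im|) ^ (3 * m + 2) * W) := by ring
    _ ≤ K ^ 3 * N ^ (-s.re) * (2 ^ (3 * m + 2) * R) := by gcongr
    _ = _ := by simp only [R]; ring

theorem what_eq_integral_mellinBarnesIntegrand {c x Y : ℝ} {w : ℝ → ℝ} {q n : ℕ}
    (hw : Continuous w) (hY : 0 < Y) (h0 : ∀ t, 0 ≤ t → t ≤ Y → w t = 0)
    (h1 : ∀ t, x ≤ t → w t = 0) (hq : 0 < q) (hn : 0 < n)
    (hg : Integrable fun t : ℝ => gammaQuotient (c + t * Complex.I) ^ 3) :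
    what c w q n = (1 / (2 * Real.pi)) *
      ∫ t : ℝ, mellinBarnesIntegrand w (Real.pi ^ 3 * n / q ^ 3) (c + t * Complex.I) := by
  have hN : 0 < Real.pi ^ 3 * n / q ^ 3 := by
    have := Real.pi_pos
    positivity
  have := integral_mul_integral_cpow_eq_mellin hw hY h0 h1 hN c hg
  simp only [mellinBarnesIntegrand]
  rw [← this, ← integral_const_mul]
  simp only [what, U, gammaQuotient]
  refine integral_congr_ae (Eventually.of_forall fun t => ?_)
  simp only
  ring

theorem what_eq_zero_of_not_integrable {c : ℝ} {w : ℝ → ℝ} {q n : ℕ} (hq : 0 < q) (hn : 0 < n)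
    (hg : ¬ Integrable fun t : ℝ => gammaQuotient (c + t * Complex.I) ^ 3) :
    what c w q n = 0 := by
  refine setIntegral_eq_zero_of_forall_eq_zero fun t ht => ?_
  have ht0 : (0 : ℝ) < t := ht
  have hX : 0 < Real.pi ^ 3 * n / q ^ 3 * t := by
    have := Real.pi_pos
    positivity
  rw [U, integral_undef, mul_zero, mul_zero]
  refine fun h => hg ?_
  set X := Real.pi ^ 3 * n / q ^ 3 * t
  have hb := h.bdd_mul (f := fun τ : ℝ => (X : ℂ) ^ ((c : ℂ) + (τ : ℂ) * Complex.I)) (c := X ^ c)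
    (Measurable.aestronglyMeasurable (Measurable.pow (by fun_prop) (by fun_prop)))
    (Eventually.of_forall fun τ => by
      rw [Complex.norm_cpow_eq_rpow_re_of_pos hX]; simp)
  refine hb.congr (Eventually.of_forall fun τ => ?_)
  have hX0 : (X : ℂ) ≠ 0 := by exact_mod_cast hX.ne'
  simp only [gammaQuotient]
  rw [mul_comm, mul_assoc, ← Complex.cpow_add _ _ hX0, neg_add_cancel, Complex.cpow_zero, mul_one]

theorem exists_norm_what_le {m : ℕ} (hm : 1 ≤ m) :
    ∃ K : ℝ, 0 < K ∧ ∀ (c x Y B C : ℝ) (w : ℝ → ℝ) (q n : ℕ), 0 < c → c ≤ m →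
      ContDiff ℝ (⊤ : ℕ∞) w → 1 ≤ Y → Y ≤ x →
      (∀ t, 0 ≤ t → t ≤ Y → w t = 0) → (∀ t, x ≤ t → w t = 0) → 0 < q → 0 < n →
      (∀ t, 0 ≤ t → |w t| ≤ B) →
      (∀ t, 0 ≤ t → |iteratedDeriv (3 * m + 2) w t| ≤ C / Y ^ (3 * m + 2)) →
      ‖what c w q n‖ ≤ K * (B + C) * ((x ^ 2 * q ^ 3 / Y ^ 3) ^ m * x ^ 3 / n ^ m) := by
  obtain ⟨K, hK, hbound⟩ := exists_norm_mellinBarnesIntegrand_le m (a := m) (by exact_mod_cast hm)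
  refine ⟨K, hK, ?_⟩
  intro c x Y B C w q n hc hcm hw hY1 hYx h0 h1 hq hn hB hC
  have hpi := Real.pi_pos
  have hY : 0 < Y := by linarith
  have hx : 0 < x := by linarith
  have hB0 : 0 ≤ B := (abs_nonneg _).trans (hB 0 le_rfl)
  have hC0 : 0 ≤ C := by
    have := (abs_nonneg _).trans (hC 0 le_rfl)
    rwa [le_div_iff₀ (by positivity), zero_mul] at this
  by_cases hg : Integrable fun t : ℝ => gammaQuotient (c + t * Complex.I) ^ 3
  swap
  · rw [what_eq_zero_of_not_integrable hq hn hg, norm_zero]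
    positivity
  set N := Real.pi ^ 3 * n / q ^ 3 with hNdef
  have hN : 0 < N := by positivity
  have hdiff : ∀ s : ℂ, c ≤ s.re → s.re ≤ m →
      DifferentiableAt ℂ (mellinBarnesIntegrand w N) s := by
    intro s hs _
    have hN0 : (N : ℂ) ≠ 0 := by exact_mod_cast hN.ne'
    exact (((differentiableAt_gammaQuotient (hc.trans_le hs)).pow 3).mul
      (DifferentiableAt.const_cpow (by fun_prop) (Or.inl hN0))).mul
      ((differentiable_mellin_of_eq_zero hw.continuous hY h0 h1 _).comp s (by fun_prop))
  obtain ⟨K', hK', hbound'⟩ := exists_norm_mellinBarnesIntegrand_le m hc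
  let r : ℝ → ℝ := fun σ => N ^ (-σ) * (x * x ^ ((3 * m + 2 : ℕ) - σ) / Y ^ (3 * m + 2))
  have hr : Continuous r := by
    have e1 : Continuous fun σ : ℝ => N ^ (-σ) :=
      Continuous.rpow continuous_const (by fun_prop) fun _ => Or.inl hN.ne'
    have e2 : Continuous fun σ : ℝ => x ^ ((3 * m + 2 : ℕ) - σ) :=
      Continuous.rpow continuous_const (by fun_prop) fun _ => Or.inl hx.ne'
    exact e1.mul ((continuous_const.mul e2).div_const _)
  obtain ⟨M, hM⟩ := (isCompact_Icc (a := c) (b := (m : ℝ))).exists_bound_of_continuousOn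
    hr.continuousOn
  have hshift := integral_vertical_line_eq_of_norm_le (M := K' * (B + C) * M) hcm hdiff
    fun s hs hsm => (hbound' w x Y B C N hw hY hYx h0 h1 hN hB hC s hs hsm).trans (by
      have := (le_abs_self _).trans (hM s.re ⟨hs, hsm⟩)
      gcongr)
  have hfin : ‖∫ t : ℝ, mellinBarnesIntegrand w N ((m : ℝ) + t * Complex.I)‖ ≤
      K * (B + C) * r m * Real.pi := by
    rw [← integral_univ_inv_one_add_sq, ← integral_const_mul]
    refine norm_integral_le_of_norm_le (integrable_inv_one_add_sq.const_mul _)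
      (Eventually.of_forall fun t => ?_)
    simpa [r] using hbound w x Y B C N hw hY hYx h0 h1 hN hB hC ((m : ℝ) + t * Complex.I)
      (by simp) (by simp)
  have hrm : r m ≤ (x ^ 2 * q ^ 3 / Y ^ 3) ^ m * x ^ 3 / n ^ m := by
    have e1 : x ^ (((3 * m + 2 : ℕ) : ℝ) - (m : ℝ)) = x ^ (2 * m + 2) := by
      rw [← Real.rpow_natCast]; congr 1; push_cast; ring
    have hp : (1 : ℝ) ≤ (Real.pi ^ 3) ^ m :=
      one_le_pow₀ (one_le_pow₀ (by linarith [Real.pi_gt_three]))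
    simp only [r]
    rw [e1, Real.rpow_neg hN.le, Real.rpow_natCast, hNdef]
    calc _ = (x ^ 2 * q ^ 3 / Y ^ 3) ^ m * x ^ 3 / n ^ m / ((Real.pi ^ 3) ^ m * Y ^ 2) := by
          rw [div_pow, mul_pow, div_pow, mul_pow, pow_add, pow_mul, pow_add, pow_mul]
          field_simp
      _ ≤ _ := div_le_self (by positivity) (one_le_mul_of_one_le_of_one_le hp (one_le_pow₀ hY1))
  rw [what_eq_integral_mellinBarnesIntegrand hw.continuous hY h0 h1 hq hn hg, hshift, norm_mul]
  have hn1 : ‖(1 / (2 * Real.pi) : ℂ)‖ = 1 / (2 * Real.pi) := by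
    rw [norm_div, norm_mul, Complex.norm_real, Real.norm_of_nonneg hpi.le]
    simp
  rw [hn1]
  have hr0 : 0 ≤ r m := by positivity
  calc _ ≤ 1 / (2 * Real.pi) * (K * (B + C) * r m * Real.pi) := by gcongr
    _ = K * (B + C) * r m / 2 := by field_simp
    _ ≤ K * (B + C) * r m := half_le_self (by positivity)
    _ ≤ _ := by gcongr

theorem pow_mul_rpow_le_pow_of_rpow_lt {D ε n : ℝ} {m : ℕ} (hD : 1 ≤ D) (hε : 0 < ε)
    (hn : D ^ (1 + ε) < n) (hm : (10302 + 2 * ε) / ε ≤ m) :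
    D ^ (m + 10300) * n ^ ((4 : ℝ) / 3) ≤ n ^ m := by
  have hD0 : 0 < D := by linarith
  have hn1 : 1 ≤ n := (Real.one_le_rpow hD (by linarith)).trans hn.le
  have hn0 : 0 < n := by linarith
  have hDn : D ≤ n ^ (1 / (1 + ε)) := by
    rw [one_div, Real.le_rpow_inv_iff_of_pos hD0.le hn0.le (by linarith)]
    exact hn.le
  have h1 : D ^ (m + 10300) ≤ n ^ (1 / (1 + ε) * (m + 10300 : ℕ)) := by
    rw [Real.rpow_mul hn0.le, Real.rpow_natCast]
    exact pow_le_pow_left₀ hD0.le hDn _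
  calc _ ≤ n ^ (1 / (1 + ε) * (m + 10300 : ℕ)) * n ^ ((4 : ℝ) / 3) := by gcongr
    _ = n ^ (1 / (1 + ε) * (m + 10300 : ℕ) + (4 : ℝ) / 3) := (Real.rpow_add hn0 _ _).symm
    _ ≤ n ^ (m : ℝ) := by
      refine Real.rpow_le_rpow_of_exponent_le hn1 ?_
      rw [div_le_iff₀ hε] at hm
      have : (1 / (1 + ε) * (m + 10300 : ℕ) + (4 : ℝ) / 3) =
        ((m + 10300) + 4 / 3 * (1 + ε)) / (1 + ε) := by push_cast; field_simp
      rw [this, div_le_iff₀ (by linarith)]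
      nlinarith
    _ = n ^ m := Real.rpow_natCast n m

end

/-- With `w` a smooth cutoff adapted to `(Y,x)` (with derivative
constants `Cd`): suppose `x²q³/Y³ ≥ x^{1/100}` and let `ε > 0`.  Then for every positive
integer `n` with `n > (x²q³/Y³)^{1+ε}`, one has `|ŵ_q(n)| ≪_ε 1/(x^{100} n^{4/3})`. -/
theorem stmt17 (Cd : ℕ → ℝ) :
    ∀ ε : ℝ, 0 < ε → ∃ C : ℝ, 0 < C ∧
      ∀ c x Y : ℝ, ∀ w : ℝ → ℝ, ∀ q n : ℕ,
        0 < c → c < 1 / 6 → 1 ≤ Y → Y ≤ x →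
        ContDiff ℝ (⊤ : ℕ∞) w →
        (∀ t : ℝ, 0 ≤ t → t ≤ Y → w t = 0) →
        (∀ t : ℝ, 2 * Y ≤ t → t ≤ x - Y → w t = 1) →
        (∀ t : ℝ, x ≤ t → w t = 0) →
        (∀ i : ℕ, ∀ t : ℝ, 0 ≤ t → |iteratedDeriv i w t| ≤ Cd i / Y ^ i) →
        1 ≤ q → 1 ≤ n →
        x ^ ((1 : ℝ) / 100) ≤ x ^ 2 * (q : ℝ) ^ 3 / Y ^ 3 →
        (x ^ 2 * (q : ℝ) ^ 3 / Y ^ 3) ^ ((1 : ℝ) + ε) < (n : ℝ) →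
        ‖what c w q n‖ ≤ C / (x ^ (100 : ℕ) * (n : ℝ) ^ ((4 : ℝ) / 3)) := by
  intro ε hε
  obtain ⟨m, hm⟩ : ∃ m : ℕ, (10302 + 2 * ε) / ε ≤ m := exists_nat_ge _
  have hm1 : 1 ≤ m := by
    have : (0 : ℝ) < m := lt_of_lt_of_le (by positivity) hm
    exact_mod_cast this
  obtain ⟨K, hK, hbound⟩ := exists_norm_what_le hm1
  refine ⟨K * (|Cd 0| + |Cd (3 * m + 2)|) + 1, by positivity, ?_⟩
  intro c x Y w q n hc hc6 hY hYx hw h0 _ h1 hd hq hn hD hDn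
  have hY0 : 0 < Y := by linarith
  have hx1 : 1 ≤ x := hY.trans hYx
  have hx : 0 < x := by linarith
  have hq0 : (0 : ℝ) < q := by exact_mod_cast hq
  have hn0 : (0 : ℝ) < n := by exact_mod_cast hn
  have hm1' : (1 : ℝ) ≤ m := by exact_mod_cast hm1
  have hmain := hbound c x Y |Cd 0| |Cd (3 * m + 2)| w q n hc (by linarith) hw hY hYx h0 h1 hq hn
    (fun t ht => by
      have := hd 0 t ht
      rw [iteratedDeriv_zero, pow_zero, div_one] at this
      exact this.trans (le_abs_self _))
    (fun t ht => (hd _ t ht).trans (by gcongr; exact le_abs_self _))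
  refine hmain.trans ?_
  set D := x ^ 2 * (q : ℝ) ^ 3 / Y ^ 3
  have hD1 : 1 ≤ D := (Real.one_le_rpow hx1 (by norm_num)).trans hD
  have hxD : x ≤ D ^ 100 := by
    have := pow_le_pow_left₀ (by positivity) hD 100
    rwa [← Real.rpow_natCast, ← Real.rpow_mul hx.le,
      show (1 : ℝ) / 100 * (100 : ℕ) = 1 by norm_num, Real.rpow_one] at this
  have hpow := pow_mul_rpow_le_pow_of_rpow_lt hD1 hε hDn hm
  have hxp : x ^ 103 ≤ D ^ 10300 := by
    calc x ^ 103 ≤ (D ^ 100) ^ 103 := pow_le_pow_left₀ hx.le hxD _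
      _ = D ^ 10300 := by rw [← pow_mul]
  have hfrac : D ^ m * x ^ 3 / n ^ m ≤ 1 / (x ^ 100 * (n : ℝ) ^ ((4 : ℝ) / 3)) := by
    rw [div_le_div_iff₀ (by positivity) (by positivity), one_mul]
    calc D ^ m * x ^ 3 * (x ^ 100 * (n : ℝ) ^ ((4 : ℝ) / 3))
        = D ^ m * x ^ 103 * (n : ℝ) ^ ((4 : ℝ) / 3) := by ring
      _ ≤ D ^ m * D ^ 10300 * (n : ℝ) ^ ((4 : ℝ) / 3) := by gcongr
      _ = D ^ (m + 10300) * (n : ℝ) ^ ((4 : ℝ) / 3) := by rw [pow_add]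
      _ ≤ _ := hpow
  calc _ ≤ K * (|Cd 0| + |Cd (3 * m + 2)|) * (1 / (x ^ 100 * (n : ℝ) ^ ((4 : ℝ) / 3))) := by gcongr
    _ = K * (|Cd 0| + |Cd (3 * m + 2)|) / (x ^ 100 * (n : ℝ) ^ ((4 : ℝ) / 3)) := by ring
    _ ≤ _ := by
      gcongr
      linarith
end
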